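/- arXiv:math/0411074 — 2 statements merged into one kernel-verified Lean document; each statement's English description precedes it below -/
import Mathlib

section
/- Let C be a bounded open convex subset of ℝⁿ whose boundary ∂C is of class C¹ and strictly convex. Then there exists a constant K = K(n) > 0, depending only on n, such that for every open set Ω with closure contained in C one has λ₁^C(Ω) ≥ K · (I_∞^C(Ω))². In particular λ₁(C) ≥ K · I_∞(C)². -/
open MeasureTheory Set Filter
open scoped ENNReal NNReal

noncomputable section

/-- Euclidean `n`-space. -/
abbrev Euc (n : ℕ) : Type := EuclideanSpace ℝ (Fin n)

/-- The set of parameters `t` such that `p + t • v` lies in `C`. For `C` open bounded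
convex, `p ∈ C` and `v ≠ 0` this is an open interval `(t⁻, t⁺)` with `t⁻ < 0 < t⁺`;
the points `p + t⁻ • v` and `p + t⁺ • v` are the two intersections of the boundary `∂C`
with the line through `p` directed by `v`. -/
def lineParams {n : ℕ} (C : Set (Euc n)) (p v : Euc n) : Set ℝ := {t : ℝ | p + t • v ∈ C}

open Classical in
/-- The Hilbert distance of the convex set `C`: with `a = p + t⁻ • (q - p)` and
`b = p + t⁺ • (q - p)` the two boundary points (so that `a, p, q, b` are in this order),
the cross-ratio `(‖q-a‖ ‖p-b‖)/(‖p-a‖ ‖q-b‖)` equals `((1 - t⁻) t⁺)/((-t⁻)(t⁺ - 1))`. -/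
def hDist {n : ℕ} (C : Set (Euc n)) (p q : Euc n) : ℝ :=
  if p = q then 0
  else
    (1 / 2) * Real.log
      (((1 - sInf (lineParams C p (q - p))) * sSup (lineParams C p (q - p))) /
        ((-sInf (lineParams C p (q - p))) * (sSup (lineParams C p (q - p)) - 1)))

open Classical in
/-- The Hilbert Finsler norm of `u` at `p`: with `p⁺ = p + t⁺ • u`, `p⁻ = p + t⁻ • u`
the two boundary points on the line through `p` directed by `u`, one has
`(1/2)‖u‖(1/‖p-p⁺‖ + 1/‖p-p⁻‖) = (1/2)(1/t⁺ - 1/t⁻)`. -/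
def fNorm {n : ℕ} (C : Set (Euc n)) (p u : Euc n) : ℝ :=
  if u = 0 then 0
  else (1 / 2) * (1 / sSup (lineParams C p u) - 1 / sInf (lineParams C p u))

/-- The dual norm of a linear form `l` at `p`: `sup {l u : ‖u‖_{C,p} = 1}`. -/
def dualNorm {n : ℕ} (C : Set (Euc n)) (p : Euc n) (l : Euc n →L[ℝ] ℝ) : ℝ :=
  sSup ((fun u => l u) '' {u : Euc n | fNorm C p u = 1})

/-- The tangent ball `TB_R(p) = {u : ‖u‖_{C,p} < R}`. -/
def tangentBall {n : ℕ} (C : Set (Euc n)) (p : Euc n) (R : ℝ) : Set (Euc n) :=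
  {u : Euc n | fNorm C p u < R}

/-- `ωₙ`, the Lebesgue volume of the Euclidean unit ball of `ℝⁿ`. -/
def omegaVol (n : ℕ) : ℝ := (volume (Metric.ball (0 : Euc n) 1)).toReal

/-- The Hilbert (Busemann) measure of `C`: density `ωₙ / vol_e(TB_C(p))` against
Lebesgue measure, supported on `C`. -/
def hMeasure {n : ℕ} (C : Set (Euc n)) : Measure (Euc n) :=
  (volume.restrict C).withDensity fun p =>
    ENNReal.ofReal (omegaVol n / (volume (tangentBall C p 1)).toReal)

/-- Admissible test functions: nonzero Lipschitz functions with compact support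
contained in `Ω`. -/
def testFuns {n : ℕ} (Ω : Set (Euc n)) : Set (Euc n → ℝ) :=
  {f : Euc n → ℝ |
    (∃ K : ℝ≥0, LipschitzWith K f) ∧ f ≠ 0 ∧ HasCompactSupport f ∧ tsupport f ⊆ Ω}

/-- The Rayleigh quotient of `f` on `Ω`, with respect to the Hilbert geometry of `C`
(`df` is the a.e.-defined differential of the Lipschitz function `f`). -/
def rayleigh {n : ℕ} (C Ω : Set (Euc n)) (f : Euc n → ℝ) : ℝ :=
  (∫ p in Ω, dualNorm C p (fderiv ℝ f p) ^ 2 ∂hMeasure C) /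
    ∫ p in Ω, f p ^ 2 ∂hMeasure C

/-- The Dirichlet bottom of the spectrum `λ₁^C(Ω)`. -/
def lambda1D {n : ℕ} (C Ω : Set (Euc n)) : ℝ := sInf (rayleigh C Ω '' testFuns Ω)

/-- The bottom of the spectrum `λ₁(C)` of the Hilbert geometry of `C`. -/
def lambda1 {n : ℕ} (C : Set (Euc n)) : ℝ := lambda1D C C

/-- The Gromov product `(x|y)_t = (d(x,t) + d(y,t) - d(x,y))/2`. -/
def gromovProd {n : ℕ} (d : Euc n → Euc n → ℝ) (x y t : Euc n) : ℝ :=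
  (d x t + d y t - d x y) / 2

/-- `(C, d_C)` is `δ`-hyperbolic: for all `x y z t` in `C`,
`(x|y)_t ≥ min((x|z)_t, (y|z)_t) - δ`. -/
def IsDeltaHyp {n : ℕ} (C : Set (Euc n)) (δ : ℝ) : Prop :=
  ∀ x ∈ C, ∀ y ∈ C, ∀ z ∈ C, ∀ t ∈ C,
    gromovProd (hDist C) x y t ≥
      min (gromovProd (hDist C) x z t) (gromovProd (hDist C) y z t) - δ

/-- The metric ball `B_R(x)` of the Hilbert metric of `C`. -/
def hBall {n : ℕ} (C : Set (Euc n)) (x : Euc n) (R : ℝ) : Set (Euc n) :=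
  {y ∈ C | hDist C x y < R}

/-- The image of `C` under the homothety of center `P₀` and ratio `r`. -/
def homoth {n : ℕ} (P₀ : Euc n) (r : ℝ) (C : Set (Euc n)) : Set (Euc n) :=
  (fun x => P₀ + r • (x - P₀)) '' C

/-- Diameter of a set with respect to a distance function `d`. -/
def ediamD {α : Type*} (d : α → α → ℝ) (S : Set α) : ℝ≥0∞ :=
  ⨆ x ∈ S, ⨆ y ∈ S, ENNReal.ofReal (d x y)

/-- The `k`-dimensional Hausdorff measure of `S` with respect to the distance
function `d`. -/
def hausD {α : Type*} (k : ℝ) (d : α → α → ℝ) (S : Set α) : ℝ≥0∞ :=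
  ⨆ (ε : ℝ≥0∞) (_ : 0 < ε),
    ⨅ (U : ℕ → Set α) (_ : S ⊆ ⋃ i, U i) (_ : ∀ i, ediamD d (U i) ≤ ε),
      ∑' i, ediamD d (U i) ^ k

/-- The frontier of `U` is a rectifiable closed curve (for the Hilbert metric of `C`):
it is the image of a closed continuous curve and has finite one-dimensional Hausdorff
measure. -/
def RectCurveBoundary (C U : Set (Euc 2)) : Prop :=
  ∃ c : ℝ → Euc 2, ContinuousOn c (Icc 0 1) ∧ c '' Icc (0 : ℝ) 1 = frontier U ∧
    c 0 = c 1 ∧ hausD 1 (hDist C) (frontier U) < ⊤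

/-- The Cheeger constant `I_∞^C(Ω)` in dimension `2`: infimum of
`ν_C(∂U)/μ_C(U)` over open sets `U` with closure contained in `Ω` whose boundary is a
rectifiable curve, `ν_C` being the `1`-dimensional Hausdorff measure of `(C, d_C)`. -/
def cheeger2D (C Ω : Set (Euc 2)) : ℝ :=
  sInf {r : ℝ | ∃ U : Set (Euc 2), IsOpen U ∧ U.Nonempty ∧ closure U ⊆ Ω ∧
    RectCurveBoundary C U ∧
    r = (hausD 1 (hDist C) (frontier U)).toReal / (hMeasure C U).toReal}

/-- The Cheeger constant `I_∞(C)` of a planar Hilbert geometry. -/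
def cheeger2 (C : Set (Euc 2)) : ℝ := cheeger2D C C

/-- `S` is a `C¹` hypersurface: near each of its points it is the zero set of a `C¹`
function with nonvanishing differential. -/
def IsC1Hypersurface {n : ℕ} (S : Set (Euc n)) : Prop :=
  ∀ x ∈ S, ∃ (f : Euc n → ℝ) (U : Set (Euc n)), U ∈ nhds x ∧ ContDiffOn ℝ 1 f U ∧
    (∀ y ∈ U, fderiv ℝ f y ≠ 0) ∧ S ∩ U = {y ∈ U | f y = 0}

/-- The Cheeger constant `I_∞^C(Ω)` in dimension `n`: infimum of `ν_C(∂U)/μ_C(U)` over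
open sets `U` with closure contained in `Ω` whose boundary is a `C¹` hypersurface,
`ν_C` being the `(n-1)`-dimensional Hausdorff measure of `(C, d_C)`. -/
def cheegerND {n : ℕ} (C Ω : Set (Euc n)) : ℝ :=
  sInf {r : ℝ | ∃ U : Set (Euc n), IsOpen U ∧ U.Nonempty ∧ closure U ⊆ Ω ∧
    IsC1Hypersurface (frontier U) ∧
    r = (hausD ((n : ℝ) - 1) (hDist C) (frontier U)).toReal / (hMeasure C U).toReal}

/-- The boundary of the convex set `C` is of class `C¹`: through each boundary point
passes a unique supporting hyperplane. -/
def HasC1Boundary {n : ℕ} (C : Set (Euc n)) : Prop :=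
  ∀ x ∈ frontier C, ∃! l : Euc n →L[ℝ] ℝ, ‖l‖ = 1 ∧ ∀ y ∈ C, l y ≤ l x

/-- The convex set `C` is strictly convex: the open segment joining two distinct
boundary points is contained in `C`. -/
def IsStrictlyConvexSet {n : ℕ} (C : Set (Euc n)) : Prop :=
  ∀ x ∈ frontier C, ∀ y ∈ frontier C, x ≠ y → openSegment ℝ x y ⊆ C

end
/-- translate of `C` to the origin -/
def trC {n : ℕ} (C : Set (Euc n)) (p : Euc n) : Set (Euc n) := {y | p + y ∈ C}

structure GoodC {n : ℕ} (C : Set (Euc n)) (R : ℝ) : Prop where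
  conv : Convex ℝ C
  op : IsOpen C
  Rpos : 0 < R
  bd : ∀ p ∈ C, ‖p‖ ≤ R

section gaugeFacts
variable {n : ℕ} {C : Set (Euc n)} {R : ℝ} {p : Euc n}

lemma trC_convex (h : GoodC C R) : Convex ℝ (trC C p) := by
  have := h.conv.translate_preimage_right p
  exact this

lemma trC_open (h : GoodC C R) : IsOpen (trC C p) :=
  h.op.preimage (by fun_prop : Continuous fun y : Euc n => p + y)

lemma trC_zero (hp : p ∈ C) : (0 : Euc n) ∈ trC C p := by simpa [trC] using hp

lemma trC_nhds (h : GoodC C R) (hp : p ∈ C) : trC C p ∈ nhds (0 : Euc n) :=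
  (trC_open h).mem_nhds (trC_zero hp)

lemma trC_abs (h : GoodC C R) (hp : p ∈ C) : Absorbent ℝ (trC C p) :=
  absorbent_nhds_zero (trC_nhds h hp)

noncomputable def gp {n : ℕ} (C : Set (Euc n)) (p u : Euc n) : ℝ := gauge (trC C p) u

lemma gp_nonneg (u : Euc n) : 0 ≤ gp C p u := gauge_nonneg _

lemma gp_add (h : GoodC C R) (hp : p ∈ C) (u v : Euc n) :
    gp C p (u + v) ≤ gp C p u + gp C p v :=
  gauge_add_le (trC_convex h) (trC_abs h hp) u v

lemma gp_smul {t : ℝ} (ht : 0 ≤ t) (u : Euc n) : gp C p (t • u) = t * gp C p u := by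
  unfold gp
  rw [gauge_smul_of_nonneg ht]; rfl

lemma gp_lt_one (h : GoodC C R) (hp : p ∈ C) (u : Euc n) : gp C p u < 1 ↔ p + u ∈ C := by
  unfold gp
  rw [gauge_lt_one_iff_mem_interior (trC_convex h) (trC_nhds h hp), (trC_open h).interior_eq]
  rfl

lemma gp_ge (h : GoodC C R) (hp : p ∈ C) (u : Euc n) : ‖u‖ / (2 * R) ≤ gp C p u := by
  apply le_gauge_of_subset_closedBall (trC_abs h hp) (by linarith [h.Rpos])
  intro y hy
  rw [mem_closedBall_zero_iff]
  have h1 := h.bd p hp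
  have h2 := h.bd _ hy
  have : ‖y‖ ≤ ‖p + y‖ + ‖p‖ := by
    have := norm_sub_le (p + y) p
    simpa using this
  linarith

lemma gp_pos (h : GoodC C R) (hp : p ∈ C) {u : Euc n} (hu : u ≠ 0) : 0 < gp C p u := by
  refine lt_of_lt_of_le ?_ (gp_ge h hp u)
  have := h.Rpos
  positivity

lemma gp_zero : gp C p 0 = 0 := gauge_zero

lemma gp_cont (h : GoodC C R) (hp : p ∈ C) : Continuous (gp C p) :=
  continuous_gauge (trC_convex h) (trC_nhds h hp)

lemma lineParams_eq (h : GoodC C R) (hp : p ∈ C) {u : Euc n} (hu : u ≠ 0) :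
    lineParams C p u = Ioo (-(gp C p (-u))⁻¹) ((gp C p u)⁻¹) := by
  have h1 := gp_pos h hp hu
  have h2 := gp_pos h hp (neg_ne_zero.mpr hu)
  ext t
  simp only [lineParams, mem_ofPred_eq, mem_Ioo]
  rw [← gp_lt_one h hp]
  rcases le_total 0 t with ht | ht
  · rw [gp_smul ht]
    constructor
    · intro h3
      refine ⟨lt_of_lt_of_le (by simpa using h2) ht, ?_⟩
      rw [← one_div, lt_div_iff₀ h1]; exact h3
    · rintro ⟨_, h4⟩
      calc t * gp C p u < (gp C p u)⁻¹ * gp C p u := by gcongr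
        _ = 1 := by field_simp
  · have : t • u = (-t) • (-u) := by simp
    rw [this, gp_smul (by linarith)]
    constructor
    · intro h3
      refine ⟨?_, lt_of_le_of_lt ht (by simpa using h1)⟩
      rw [neg_lt, ← one_div, lt_div_iff₀ h2]; exact h3
    · rintro ⟨h4, _⟩
      rw [neg_lt, ← one_div, lt_div_iff₀ h2] at h4; exact h4

lemma sSup_line (h : GoodC C R) (hp : p ∈ C) {u : Euc n} (hu : u ≠ 0) :
    sSup (lineParams C p u) = (gp C p u)⁻¹ := by
  have h1 := inv_pos.mpr (gp_pos h hp hu)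
  have h2 := inv_pos.mpr (gp_pos h hp (neg_ne_zero.mpr hu))
  rw [lineParams_eq h hp hu, csSup_Ioo (by linarith)]

lemma sInf_line (h : GoodC C R) (hp : p ∈ C) {u : Euc n} (hu : u ≠ 0) :
    sInf (lineParams C p u) = -(gp C p (-u))⁻¹ := by
  have h1 := inv_pos.mpr (gp_pos h hp hu)
  have h2 := inv_pos.mpr (gp_pos h hp (neg_ne_zero.mpr hu))
  rw [lineParams_eq h hp hu, csInf_Ioo (by linarith)]

lemma fNorm_eq (h : GoodC C R) (hp : p ∈ C) (u : Euc n) :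
    fNorm C p u = (1 / 2) * (gp C p u + gp C p (-u)) := by
  unfold fNorm
  split_ifs with hu
  · subst hu; simp [gp_zero]
  · rw [sSup_line h hp hu, sInf_line h hp hu]
    simp

lemma fNorm_neg (h : GoodC C R) (hp : p ∈ C) (u : Euc n) : fNorm C p (-u) = fNorm C p u := by
  rw [fNorm_eq h hp, fNorm_eq h hp, neg_neg, add_comm]

lemma fNorm_nonneg (h : GoodC C R) (hp : p ∈ C) (u : Euc n) : 0 ≤ fNorm C p u := by
  rw [fNorm_eq h hp]
  linarith [gp_nonneg (C := C) (p := p) u, gp_nonneg (C := C) (p := p) (-u)]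

lemma gp_le_fNorm (h : GoodC C R) (hp : p ∈ C) (u : Euc n) : gp C p u ≤ 2 * fNorm C p u := by
  rw [fNorm_eq h hp]
  linarith [gp_nonneg (C := C) (p := p) (-u)]

lemma fNorm_add (h : GoodC C R) (hp : p ∈ C) (u v : Euc n) :
    fNorm C p (u + v) ≤ fNorm C p u + fNorm C p v := by
  rw [fNorm_eq h hp, fNorm_eq h hp, fNorm_eq h hp, neg_add]
  linarith [gp_add h hp u v, gp_add h hp (-u) (-v)]

lemma fNorm_smul_nonneg (h : GoodC C R) (hp : p ∈ C) {t : ℝ} (ht : 0 ≤ t) (u : Euc n) :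
    fNorm C p (t • u) = t * fNorm C p u := by
  rw [fNorm_eq h hp, fNorm_eq h hp, ← smul_neg, gp_smul ht, gp_smul ht]; ring

lemma fNorm_cont (h : GoodC C R) (hp : p ∈ C) : Continuous (fNorm C p) := by
  have : fNorm C p = fun u => (1 / 2) * (gp C p u + gp C p (-u)) := funext (fNorm_eq h hp)
  rw [this]
  have := gp_cont h hp
  fun_prop

lemma fNorm_zero : fNorm C p 0 = 0 := by simp [fNorm]

lemma norm_le_fNorm (h : GoodC C R) (hp : p ∈ C) (u : Euc n) : ‖u‖ ≤ 2 * R * fNorm C p u := by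
  have h1 := gp_ge h hp u
  have h2 := gp_ge h hp (-u)
  have hR := h.Rpos
  rw [norm_neg] at h2
  rw [fNorm_eq h hp]
  rw [div_le_iff₀ (by linarith)] at h1 h2
  linarith

lemma fNorm_pos (h : GoodC C R) (hp : p ∈ C) {u : Euc n} (hu : u ≠ 0) : 0 < fNorm C p u := by
  rw [fNorm_eq h hp]
  linarith [gp_nonneg (C := C) (p := p) (-u), gp_pos h hp hu]

/-- comparison of gauges -/
lemma gp_shift (h : GoodC C R) (hp : p ∈ C) {w : Euc n} {s : ℝ} (hs : s < 1)
    (hw : gp C p w ≤ s) : p + w ∈ C ∧ ∀ v, (1 - s) * gp C (p + w) v ≤ gp C p v := by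
  have hm : p + w ∈ C := (gp_lt_one h hp w).1 (lt_of_le_of_lt hw hs)
  refine ⟨hm, fun v => ?_⟩
  -- enough for every a > gp v
  apply le_of_forall_gt
  intro a ha
  have ha0 : 0 < a := lt_of_le_of_lt (gp_nonneg v) ha
  set t : ℝ := (1 - s) / a with ht
  have ht0 : 0 < t := div_pos (by linarith) ha0
  have h1 : gp C p (w + t • v) < 1 := by
    calc gp C p (w + t • v) ≤ gp C p w + gp C p (t • v) := gp_add h hp _ _
      _ = gp C p w + t * gp C p v := by rw [gp_smul ht0.le]
      _ < s + t * a := by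
          have := mul_lt_mul_of_pos_left ha ht0
          linarith
      _ = 1 := by rw [ht]; field_simp; ring
  rw [gp_lt_one h hp, ← add_assoc, ← gp_lt_one h hm, gp_smul ht0.le] at h1
  rw [ht, div_mul_eq_mul_div, div_lt_one ha0] at h1
  exact h1

lemma fNorm_shift (h : GoodC C R) (hp : p ∈ C) {w : Euc n} {s : ℝ} (hs : s < 1 / 4)
    (hw : fNorm C p w ≤ s) : p + w ∈ C ∧
      (∀ v, (1 - 4 * s) * fNorm C (p + w) v ≤ fNorm C p v) ∧
      (∀ v, (1 - 4 * s) * fNorm C p v ≤ fNorm C (p + w) v) := by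
  have hs0 : 0 ≤ s := (fNorm_nonneg h hp w).trans hw
  have h1 : gp C p w ≤ 2 * s := (gp_le_fNorm h hp w).trans (by linarith)
  have h2 : gp C p (-w) ≤ 2 * s := by
    have := gp_le_fNorm h hp (-w)
    rw [fNorm_neg h hp] at this; linarith
  obtain ⟨hm, h3⟩ := gp_shift h hp (by linarith) h1
  have h4 : gp C (p + w) (-w) ≤ 4 * s := by
    have h5 := h3 (-w)
    have h6 := gp_nonneg (C := C) (p := p + w) (-w)
    nlinarith
  obtain ⟨_, h5⟩ := gp_shift h hm (by linarith) h4
  rw [add_neg_cancel_right] at h5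
  refine ⟨hm, fun v => ?_, fun v => ?_⟩
  · rw [fNorm_eq h hp, fNorm_eq h hm]
    have a1 := h3 v
    have a2 := h3 (-v)
    have a3 := gp_nonneg (C := C) (p := p + w) v
    have a4 := gp_nonneg (C := C) (p := p + w) (-v)
    nlinarith
  · rw [fNorm_eq h hp, fNorm_eq h hm]
    have a1 := h5 v
    have a2 := h5 (-v)
    nlinarith

lemma fNorm_shift' (h : GoodC C R) (hp : p ∈ C) {q : Euc n}
    (hw : fNorm C p (q - p) ≤ 1 / 8) : q ∈ C ∧
      (∀ v, fNorm C q v ≤ 2 * fNorm C p v) ∧ (∀ v, fNorm C p v ≤ 2 * fNorm C q v) := by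
  obtain ⟨h1, h2, h3⟩ := fNorm_shift h hp (by norm_num) hw
  rw [add_sub_cancel] at h1 h2 h3
  refine ⟨h1, fun v => ?_, fun v => ?_⟩
  · have := h2 v; linarith
  · have := h3 v; linarith

lemma hDist_le (h : GoodC C R) (hp : p ∈ C) {q : Euc n} (hq : fNorm C p (q - p) ≤ 1 / 4) :
    hDist C p q ≤ 2 * fNorm C p (q - p) := by
  unfold hDist
  split_ifs with hpq
  · linarith [fNorm_nonneg h hp (q - p)]
  · have hv : q - p ≠ 0 := sub_ne_zero.mpr (Ne.symm hpq)
    rw [sSup_line h hp hv, sInf_line h hp hv]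
    have hb := gp_le_fNorm h hp (q - p)
    have h1 := gp_pos h hp hv
    have h2 := gp_pos h hp (neg_ne_zero.mpr hv)
    rw [fNorm_eq h hp (q - p)] at *
    set a := gp C p (-(q - p))
    set b := gp C p (q - p)
    have hb2 : b ≤ 1 / 2 := by linarith
    have e : ((1 - -a⁻¹) * b⁻¹) / (- -a⁻¹ * (b⁻¹ - 1)) = (1 + a) / (1 - b) := by
      have : 1 - b ≠ 0 := by linarith
      have : b⁻¹ - 1 ≠ 0 := by
        intro h0
        have : b = 1 := by
          have : b⁻¹ = 1 := by linarith
          simpa using this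
        linarith
      field_simp
      ring
    rw [e]
    have h3 : 0 < (1 + a) / (1 - b) := div_pos (by linarith) (by linarith)
    have h4 := Real.log_le_sub_one_of_pos h3
    have h5 : (1 + a) / (1 - b) - 1 ≤ 2 * (a + b) := by
      rw [sub_le_iff_le_add, div_le_iff₀ (by linarith)]
      nlinarith
    linarith

end gaugeFacts
section dualFacts
variable {n : ℕ} {C : Set (Euc n)} {R : ℝ} {p : Euc n}

lemma dN_le {a : ℝ} (ha : 0 ≤ a) {l : Euc n →L[ℝ] ℝ} (hl : ∀ u, l u ≤ a * fNorm C p u) :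
    dualNorm C p l ≤ a := by
  apply Real.sSup_le _ ha
  rintro _ ⟨u, hu, rfl⟩
  have := hl u
  rw [mem_ofPred_eq] at hu
  rwa [hu, mul_one] at this

lemma dN_bdd (h : GoodC C R) (hp : p ∈ C) (l : Euc n →L[ℝ] ℝ) :
    BddAbove ((fun u => l u) '' {u : Euc n | fNorm C p u = 1}) := by
  refine ⟨‖l‖ * (2 * R), ?_⟩
  rintro _ ⟨u, hu, rfl⟩
  rw [mem_ofPred_eq] at hu
  have h1 := norm_le_fNorm h hp u
  rw [hu, mul_one] at h1
  calc l u ≤ ‖l u‖ := Real.le_norm_self _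
    _ ≤ ‖l‖ * ‖u‖ := l.le_opNorm u
    _ ≤ _ := by gcongr

lemma le_dN (h : GoodC C R) (hp : p ∈ C) (l : Euc n →L[ℝ] ℝ) (u : Euc n) :
    l u ≤ dualNorm C p l * fNorm C p u := by
  by_cases hu : u = 0
  · subst hu; simp [fNorm_zero]
  have h1 := fNorm_pos h hp hu
  have h2 : l ((fNorm C p u)⁻¹ • u) ≤ dualNorm C p l := by
    apply le_csSup (dN_bdd h hp l)
    refine ⟨_, ?_, rfl⟩
    rw [mem_ofPred_eq, fNorm_smul_nonneg h hp (inv_nonneg.mpr h1.le)]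
    field_simp
  rw [map_smul, smul_eq_mul, inv_mul_le_iff₀ h1] at h2
  linarith

lemma dN_nonneg (h : GoodC C R) (hp : p ∈ C) (l : Euc n →L[ℝ] ℝ) : 0 ≤ dualNorm C p l := by
  by_cases hu : ∃ u : Euc n, u ≠ 0
  · obtain ⟨u, hu⟩ := hu
    have h1 := le_dN h hp l u
    have h2 := le_dN h hp l (-u)
    rw [fNorm_neg h hp, map_neg] at h2
    have h3 := fNorm_pos h hp hu
    by_contra hc
    push Not at hc
    nlinarith
  · push Not at hu
    have : {u : Euc n | fNorm C p u = 1} = ∅ := by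
      ext u
      simp [hu u, fNorm_zero]
    unfold dualNorm
    rw [this]; simp

lemma abs_le_dN (h : GoodC C R) (hp : p ∈ C) (l : Euc n →L[ℝ] ℝ) (u : Euc n) :
    |l u| ≤ dualNorm C p l * fNorm C p u := by
  rw [abs_le']
  refine ⟨le_dN h hp l u, ?_⟩
  have := le_dN h hp l (-u)
  rwa [fNorm_neg h hp, map_neg] at this

lemma dN_add (h : GoodC C R) (hp : p ∈ C) (l m : Euc n →L[ℝ] ℝ) :
    dualNorm C p (l + m) ≤ dualNorm C p l + dualNorm C p m := by
  apply dN_le (add_nonneg (dN_nonneg h hp l) (dN_nonneg h hp m))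
  intro u
  have h1 := le_dN h hp l u
  have h2 := le_dN h hp m u
  simp only [add_apply]
  linarith

lemma dN_le_norm (h : GoodC C R) (hp : p ∈ C) (l : Euc n →L[ℝ] ℝ) :
    dualNorm C p l ≤ 2 * R * ‖l‖ := by
  have hR := h.Rpos
  apply dN_le (by positivity)
  intro u
  calc l u ≤ ‖l u‖ := Real.le_norm_self _
    _ ≤ ‖l‖ * ‖u‖ := l.le_opNorm u
    _ ≤ ‖l‖ * (2 * R * fNorm C p u) := by gcongr; exact norm_le_fNorm h hp u
    _ = _ := by ring

lemma dN_zero (h : GoodC C R) (hp : p ∈ C) : dualNorm C p 0 = 0 :=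
  le_antisymm (by simpa using dN_le_norm h hp 0) (dN_nonneg h hp 0)

lemma dN_smul_le (h : GoodC C R) (hp : p ∈ C) (c : ℝ) (l : Euc n →L[ℝ] ℝ) :
    dualNorm C p (c • l) ≤ |c| * dualNorm C p l := by
  apply dN_le (mul_nonneg (abs_nonneg _) (dN_nonneg h hp l))
  intro u
  have := abs_le_dN h hp l u
  calc (c • l) u = c * l u := rfl
    _ ≤ |c * l u| := le_abs_self _
    _ = |c| * |l u| := abs_mul _ _
    _ ≤ |c| * (dualNorm C p l * fNorm C p u) := by gcongr
    _ = _ := by ring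

lemma dN_sub (h : GoodC C R) (hp : p ∈ C) (l m : Euc n →L[ℝ] ℝ) :
    dualNorm C p l ≤ dualNorm C p m + 2 * R * ‖l - m‖ := by
  have h1 := dN_add h hp m (l - m)
  have h2 := dN_le_norm h hp (l - m)
  rw [add_sub_cancel] at h1
  linarith

lemma dN_shift (h : GoodC C R) (hp : p ∈ C) {q : Euc n} (hq : q ∈ C) {c : ℝ} (hc : 0 < c)
    (hpq : ∀ v, c * fNorm C q v ≤ fNorm C p v) (l : Euc n →L[ℝ] ℝ) :
    c * dualNorm C p l ≤ dualNorm C q l := by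
  rw [mul_comm, ← le_div_iff₀ hc]
  apply dN_le (div_nonneg (dN_nonneg h hq l) hc.le)
  intro u
  have h1 := le_dN h hq l u
  have h2 := hpq u
  have h3 := dN_nonneg h hq l
  rw [div_mul_eq_mul_div, le_div_iff₀ hc]
  calc l u * c ≤ dualNorm C q l * fNorm C q u * c := by gcongr
    _ = dualNorm C q l * (c * fNorm C q u) := by ring
    _ ≤ _ := by gcongr

lemma contAt_of_shift (h : GoodC C R) (hp : p ∈ C) {φ : Euc n → ℝ} (k : ℕ)
    (hφ : ∀ q, fNorm C p (q - p) < 1 / 4 →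
      (1 - 4 * fNorm C p (q - p)) ^ k * φ p ≤ φ q ∧
      (1 - 4 * fNorm C p (q - p)) ^ k * φ q ≤ φ p) : ContinuousAt φ p := by
  have hN : Tendsto (fun q => 1 - 4 * fNorm C p (q - p)) (nhds p) (nhds 1) := by
    have : Continuous (fun q => 1 - 4 * fNorm C p (q - p)) := by
      have := fNorm_cont h hp
      fun_prop
    have h2 := this.tendsto p
    simpa [fNorm_zero] using h2
  have hN2 := hN.pow k
  rw [one_pow] at hN2
  have ev : ∀ᶠ q in nhds p, 0 < 1 - 4 * fNorm C p (q - p) :=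
    hN.eventually (lt_mem_nhds (by norm_num))
  apply tendsto_of_tendsto_of_tendsto_of_le_of_le'
    (g := fun q => (1 - 4 * fNorm C p (q - p)) ^ k * φ p)
    (h := fun q => φ p / (1 - 4 * fNorm C p (q - p)) ^ k)
  · simpa using hN2.mul_const (φ p)
  · have := (tendsto_const_nhds (x := φ p)).div hN2 (by norm_num)
    rw [div_one] at this
    exact this
  · filter_upwards [ev] with q hq
    exact (hφ q (by linarith)).1
  · filter_upwards [ev] with q hq
    rw [le_div_iff₀ (by positivity), mul_comm]
    exact (hφ q (by linarith)).2

lemma dN_contAt (h : GoodC C R) (hp : p ∈ C) (l : Euc n →L[ℝ] ℝ) :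
    ContinuousAt (fun q => dualNorm C q l) p := by
  apply contAt_of_shift h hp 1
  intro q hq
  obtain ⟨h1, h2, h3⟩ := fNorm_shift h hp hq le_rfl
  rw [add_sub_cancel] at h1 h2 h3
  rw [pow_one]
  exact ⟨dN_shift h hp h1 (by linarith) h2 l, dN_shift h h1 hp (by linarith) h3 l⟩

lemma dN_contOn (h : GoodC C R) :
    ContinuousOn (fun z : Euc n × (Euc n →L[ℝ] ℝ) => dualNorm C z.1 z.2) (C ×ˢ univ) := by
  apply continuousOn_prod_of_continuousOn_lipschitzOnWith' _ (2 * R).toNNReal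
  · intro a ha
    apply LipschitzOnWith.of_dist_le_mul
    intro l _ m _
    rw [Real.coe_toNNReal _ (by linarith [h.Rpos]), Real.dist_eq, dist_eq_norm, abs_sub_le_iff]
    have h1 := dN_sub h ha l m
    have h2 := dN_sub h ha m l
    rw [norm_sub_rev] at h2
    constructor <;> simp only <;> linarith
  · intro l _ a ha
    exact (dN_contAt h ha l).continuousWithinAt

open scoped Pointwise in
lemma TB_smul (h : GoodC C R) (hp : p ∈ C) {r : ℝ} (hr : 0 < r) :
    {u | fNorm C p u < r} = r • tangentBall C p 1 := by
  ext u
  rw [mem_smul_set_iff_inv_smul_mem₀ hr.ne']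
  simp only [tangentBall, mem_ofPred_eq]
  rw [fNorm_smul_nonneg h hp (inv_nonneg.mpr hr.le), inv_mul_lt_iff₀ hr, mul_one]

open scoped Pointwise in
lemma vol_TB_r (h : GoodC C R) (hp : p ∈ C) {r : ℝ} (hr : 0 < r) :
    volume {u | fNorm C p u < r} = ENNReal.ofReal (r ^ n) * volume (tangentBall C p 1) := by
  rw [TB_smul h hp hr, Measure.addHaar_smul]
  simp [abs_of_pos (pow_pos hr n)]

lemma vol_TB_fin (h : GoodC C R) (hp : p ∈ C) : volume (tangentBall C p 1) < ⊤ := by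
  refine lt_of_le_of_lt (measure_mono ?_) (measure_closedBall_lt_top (x := (0 : Euc n)) (r := 2 * R))
  intro u hu
  have h1 := norm_le_fNorm h hp u
  have hR := h.Rpos
  simp only [tangentBall, mem_ofPred_eq] at hu
  rw [mem_closedBall_zero_iff]
  nlinarith

lemma vol_TB_pos (h : GoodC C R) (hp : p ∈ C) : 0 < volume (tangentBall C p 1) := by
  apply IsOpen.measure_pos
  · exact isOpen_lt (fNorm_cont h hp) continuous_const
  · exact ⟨0, by simp [tangentBall, fNorm_zero]⟩

lemma vol_TB_shift (h : GoodC C R) (hp : p ∈ C) {q : Euc n} {c : ℝ} (hc : 0 < c)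
    (hpq : ∀ v, c * fNorm C q v ≤ fNorm C p v) (hq : q ∈ C) :
    c ^ n * (volume (tangentBall C p 1)).toReal ≤ (volume (tangentBall C q 1)).toReal := by
  have h1 : volume {u | fNorm C p u < c} ≤ volume (tangentBall C q 1) := by
    apply measure_mono
    intro u hu
    simp only [tangentBall, mem_ofPred_eq] at *
    have := hpq u
    nlinarith
  rw [vol_TB_r h hp hc] at h1
  have := ENNReal.toReal_mono (vol_TB_fin h hq).ne h1
  rwa [ENNReal.toReal_mul, ENNReal.toReal_ofReal (by positivity)] at this

lemma vol_TB_contAt (h : GoodC C R) (hp : p ∈ C) :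
    ContinuousAt (fun q => (volume (tangentBall C q 1)).toReal) p := by
  apply contAt_of_shift h hp n
  intro q hq
  obtain ⟨h1, h2, h3⟩ := fNorm_shift h hp hq le_rfl
  rw [add_sub_cancel] at h1 h2 h3
  exact ⟨vol_TB_shift h hp (by linarith) h2 h1, vol_TB_shift h h1 (by linarith) h3 hp⟩

lemma omega_pos : 0 < omegaVol n := by
  unfold omegaVol
  exact ENNReal.toReal_pos (Metric.measure_ball_pos _ _ one_pos).ne' measure_ball_lt_top.ne

noncomputable def hdens {n : ℕ} (C : Set (Euc n)) (p : Euc n) : ℝ :=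
  omegaVol n / (volume (tangentBall C p 1)).toReal

lemma TBr_pos (h : GoodC C R) (hp : p ∈ C) : 0 < (volume (tangentBall C p 1)).toReal :=
  ENNReal.toReal_pos (vol_TB_pos h hp).ne' (vol_TB_fin h hp).ne

lemma hdens_contOn (h : GoodC C R) : ContinuousOn (hdens C) C := by
  intro p hp
  exact (continuousAt_const.div (vol_TB_contAt h hp) (TBr_pos h hp).ne').continuousWithinAt

lemma hMeasure_apply (C : Set (Euc n)) {A : Set (Euc n)} (hA : MeasurableSet A) (hAC : A ⊆ C) :
    hMeasure C A = ∫⁻ q in A, ENNReal.ofReal (hdens C q) := by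
  unfold hMeasure
  rw [withDensity_apply _ hA, Measure.restrict_restrict hA, inter_eq_self_of_subset_left hAC]
  rfl

lemma hMeasure_ac (C : Set (Euc n)) : hMeasure C ≪ volume.restrict C :=
  withDensity_absolutelyContinuous _ _

lemma hMeasure_ac' (C : Set (Euc n)) : hMeasure C ≪ volume :=
  (hMeasure_ac C).trans Measure.absolutelyContinuous_restrict

lemma hMeasure_compact (h : GoodC C R) {S : Set (Euc n)} (hS : IsCompact S) (hSC : S ⊆ C) :
    hMeasure C S < ⊤ := by
  rw [hMeasure_apply C hS.measurableSet hSC]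
  obtain ⟨b, hb⟩ := (hS.image_of_continuousOn ((hdens_contOn h).mono hSC)).bddAbove
  calc ∫⁻ q in S, ENNReal.ofReal (hdens C q) ≤ ∫⁻ q in S, ENNReal.ofReal b := by
        apply setLIntegral_mono measurable_const
        intro q hq
        exact ENNReal.ofReal_le_ofReal (hb ⟨q, hq, rfl⟩)
    _ = ENNReal.ofReal b * volume S := by simp
    _ < ⊤ := ENNReal.mul_lt_top ENNReal.ofReal_lt_top hS.measure_lt_top

def hB {n : ℕ} (C : Set (Euc n)) (p : Euc n) (r : ℝ) : Set (Euc n) := {q | fNorm C p (q - p) < r}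

lemma hB_open (h : GoodC C R) (hp : p ∈ C) (r : ℝ) : IsOpen (hB C p r) := by
  have := fNorm_cont h hp
  exact isOpen_lt (by fun_prop) continuous_const

lemma hB_self {r : ℝ} (hr : 0 < r) : p ∈ hB C p r := by simpa [hB, fNorm_zero] using hr

lemma hB_sub (h : GoodC C R) (hp : p ∈ C) {r : ℝ} (hr : r ≤ 1 / 8) : hB C p r ⊆ C := by
  intro q hq
  exact (fNorm_shift' h hp (le_of_lt (lt_of_lt_of_le hq hr))).1

lemma hB_vol (h : GoodC C R) (hp : p ∈ C) {r : ℝ} (hr : 0 < r) :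
    volume (hB C p r) = ENNReal.ofReal (r ^ n) * volume (tangentBall C p 1) := by
  rw [← vol_TB_r h hp hr]
  have : hB C p r = (fun q => q + (-p)) ⁻¹' {u | fNorm C p u < r} := by
    ext q; simp [hB, sub_eq_add_neg]
  rw [this, measure_preimage_add_right]

lemma hMeasure_hB (h : GoodC C R) (hp : p ∈ C) {r : ℝ} (hr : 0 < r) (hr8 : r ≤ 1 / 8) :
    ENNReal.ofReal (omegaVol n / 2 ^ n * r ^ n) ≤ hMeasure C (hB C p r) := by
  rw [hMeasure_apply C (hB_open h hp r).measurableSet (hB_sub h hp hr8)]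
  have hv := TBr_pos h hp
  calc ENNReal.ofReal (omegaVol n / 2 ^ n * r ^ n)
      = ENNReal.ofReal (omegaVol n / (2 ^ n * (volume (tangentBall C p 1)).toReal)) *
          volume (hB C p r) := by
        rw [hB_vol h hp hr, ← ENNReal.ofReal_toReal (vol_TB_fin h hp).ne,
          ← ENNReal.ofReal_mul (by positivity), ← ENNReal.ofReal_mul]
        · congr 1
          rw [ENNReal.toReal_ofReal hv.le]
          field_simp
        · have := omega_pos (n := n)
          positivity
    _ = ∫⁻ q in hB C p r,
          ENNReal.ofReal (omegaVol n / (2 ^ n * (volume (tangentBall C p 1)).toReal)) := by simp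
    _ ≤ _ := by
        apply setLIntegral_mono' (hB_open h hp r).measurableSet
        intro q hq
        obtain ⟨h1, h2, h3⟩ := fNorm_shift' h hp (le_of_lt (lt_of_lt_of_le hq hr8))
        apply ENNReal.ofReal_le_ofReal
        unfold hdens
        have h4 := vol_TB_shift h h1 (q := p) (c := 1 / 2) (by norm_num)
          (fun v => by have := h3 v; linarith) hp
        have h5 := TBr_pos h h1
        have := omega_pos (n := n)
        apply div_le_div_of_nonneg_left this.le h5
        rw [one_div, inv_pow, inv_mul_le_iff₀ (by positivity)] at h4
        exact h4

lemma dN_aem (h : GoodC C R) {L : Euc n → (Euc n →L[ℝ] ℝ)} (hL : Measurable L) :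
    AEMeasurable (fun q => dualNorm C q (L q)) (hMeasure C) := by
  refine AEMeasurable.mono_ac ?_ (hMeasure_ac C)
  have h1 : Measurable (fun z : (C ×ˢ (univ : Set (Euc n →L[ℝ] ℝ)) : Set _) =>
      dualNorm C z.1.1 z.1.2) := (continuousOn_iff_continuous_domRestrict.1 (dN_contOn h)).measurable
  rw [aemeasurable_restrict_iff_comap_subtype h.op.measurableSet]
  have h2 : Measurable (fun q : C => (⟨(q.1, L q.1), ⟨q.2, mem_univ _⟩⟩ :
      (C ×ˢ (univ : Set (Euc n →L[ℝ] ℝ)) : Set _))) := by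
    apply Measurable.subtype_mk
    exact measurable_subtype_coe.prodMk (hL.comp measurable_subtype_coe)
  exact (h1.comp h2).aemeasurable

end dualFacts
section coarea
variable {n : ℕ} {C : Set (Euc n)} {R : ℝ} {p : Euc n}

lemma hausD_le_liminf {α : Type*} {k : ℝ} {d : α → α → ℝ} {S : Set α} {Φ : ℕ → ℝ≥0∞}
    {δ : ℕ → ℝ≥0∞} (hδ : Tendsto δ atTop (nhds 0))
    (H : ∀ j, ∃ U : ℕ → Set α, S ⊆ ⋃ i, U i ∧ (∀ i, ediamD d (U i) ≤ δ j) ∧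
      ∑' i, ediamD d (U i) ^ k ≤ Φ j) : hausD k d S ≤ liminf Φ atTop := by
  unfold hausD
  refine iSup₂_le fun ε hε => ?_
  apply le_liminf_of_le
  · isBoundedDefault
  filter_upwards [hδ.eventually (gt_mem_nhds hε)] with j hj
  obtain ⟨U, h1, h2, h3⟩ := H j
  exact (iInf₂_le U h1).trans ((iInf_le _ fun i => (h2 i).trans hj.le).trans h3)

lemma ediamD_empty {α : Type*} (d : α → α → ℝ) : ediamD d ∅ = 0 := by simp [ediamD]

lemma cover_exists (h : GoodC C R) {S : Set (Euc n)} (hS : S ⊆ C) {δ : ℝ} (hδ : 0 < δ)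
    (hδ2 : δ ≤ 1 / 80) : ∃ u ⊆ S, u.Countable ∧ u.PairwiseDisjoint (fun b => hB C b δ) ∧
      S ⊆ ⋃ b ∈ u, hB C b (5 * δ) := by
  obtain ⟨u, hu, hd, hc⟩ := Vitali.exists_disjoint_subfamily_covering_enlargement
    (fun b => hB C b δ) S (fun _ => 1) 2 (by norm_num) (fun _ _ => by norm_num) 1
    (fun _ _ => le_rfl) (fun a _ => ⟨a, hB_self hδ⟩)
  refine ⟨u, hu, hd.countable_of_isOpen (fun b hb => hB_open h (hS (hu hb)) _)
    (fun b _ => ⟨b, hB_self hδ⟩), hd, ?_⟩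
  intro p hp
  obtain ⟨b, hb, ⟨z, hz1, hz2⟩, _⟩ := hc p hp
  have hbC := hS (hu hb)
  have hpC := hS hp
  simp only [hB, mem_ofPred_eq] at hz1 hz2
  obtain ⟨hzC, a1, a2⟩ := fNorm_shift' h hpC (q := z) (by linarith)
  obtain ⟨_, b1, b2⟩ := fNorm_shift' h hbC (q := z) (by linarith)
  refine mem_iUnion₂.2 ⟨b, hb, ?_⟩
  simp only [hB, mem_ofPred_eq]
  have c1 := a1 (p - z)
  have c2 := b2 (p - z)
  have c3 : fNorm C p (p - z) = fNorm C p (z - p) := by rw [← fNorm_neg h hpC, neg_sub]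
  have c4 := fNorm_add h hbC (p - z) (z - b)
  rw [sub_add_sub_cancel] at c4
  linarith

lemma hB_hDist (h : GoodC C R) (hp : p ∈ C) {δ : ℝ}
    (hδ2 : δ ≤ 1 / 80) {x y : Euc n} (hx : x ∈ hB C p (5 * δ)) (hy : y ∈ hB C p (5 * δ)) :
    hDist C x y ≤ 40 * δ := by
  simp only [hB, mem_ofPred_eq] at hx hy
  obtain ⟨hxC, a1, a2⟩ := fNorm_shift' h hp (q := x) (by linarith)
  have c4 := fNorm_add h hp (y - p) (-(x - p))
  rw [fNorm_neg h hp, show y - p + -(x - p) = y - x by abel] at c4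
  have := a1 (y - x)
  have := hDist_le h hxC (q := y) (by linarith)
  linarith

lemma hB_ediam (h : GoodC C R) (hp : p ∈ C) {δ : ℝ} (hδ2 : δ ≤ 1 / 80) {A : Set (Euc n)}
    (hA : A ⊆ hB C p (5 * δ)) : ediamD (hDist C) A ≤ ENNReal.ofReal (40 * δ) := by
  refine iSup₂_le fun x hx => iSup₂_le fun y hy => ?_
  exact ENNReal.ofReal_le_ofReal (hB_hDist h hp hδ2 (hA hx) (hA hy))

lemma hB_convex (h : GoodC C R) (hp : p ∈ C) (r : ℝ) : Convex ℝ (hB C p r) := by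
  intro x hx y hy a b ha hb hab
  simp only [hB, mem_ofPred_eq] at *
  have e : a • x + b • y - p = a • (x - p) + b • (y - p) := by
    have : p = (a + b) • p := by rw [hab, one_smul]
    conv_lhs => rw [this]
    module
  rw [e]
  refine (fNorm_add h hp _ _).trans_lt ?_
  rw [fNorm_smul_nonneg h hp ha, fNorm_smul_nonneg h hp hb]
  rcases ha.eq_or_lt with h0 | h0
  · subst h0
    have : b = 1 := by linarith
    subst this; linarith
  · have e1 : a * fNorm C p (x - p) < a * r := by gcongr
    have e2 : b * fNorm C p (y - p) ≤ b * r := by gcongr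
    have e3 : a * r + b * r = r := by rw [← add_mul, hab, one_mul]
    linarith

lemma osc_le (h : GoodC C R) (hp : p ∈ C) {r η : ℝ} {G : Euc n → ℝ} (hr : 0 < r) (hη : 0 ≤ η)
    (hG : Differentiable ℝ G)
    (hcl : ∀ z ∈ hB C p r, ‖fderiv ℝ G z - fderiv ℝ G p‖ ≤ η) {x : Euc n} (hx : x ∈ hB C p r) :
    |G x - G p| ≤ r * (dualNorm C p (fderiv ℝ G p) + 2 * R * η) := by
  have h1 := (hB_convex h hp r).norm_image_sub_le_of_norm_fderiv_le' (𝕜 := ℝ) (f := G)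
    (φ := fderiv ℝ G p) (C := η) (fun z _ => hG z) hcl (hB_self hr) hx
  have h2 := abs_le_dN h hp (fderiv ℝ G p) (x - p)
  have h3 := norm_le_fNorm h hp (x - p)
  simp only [hB, mem_ofPred_eq] at hx
  have h4 := dN_nonneg h hp (fderiv ℝ G p)
  have hR := h.Rpos
  rw [Real.norm_eq_abs] at h1
  have h5 : |G x - G p| ≤ |G x - G p - (fderiv ℝ G p) (x - p)| + |(fderiv ℝ G p) (x - p)| := by
    have := abs_add_le (G x - G p - (fderiv ℝ G p) (x - p)) ((fderiv ℝ G p) (x - p))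
    simpa using this
  have h6 : η * ‖x - p‖ ≤ η * (2 * R * r) := by
    gcongr
    exact h3.trans (by gcongr)
  have h7 : dualNorm C p (fderiv ℝ G p) * fNorm C p (x - p) ≤
      dualNorm C p (fderiv ℝ G p) * r := by gcongr
  linarith

noncomputable def cc (n : ℕ) : ℝ := 2 * (80 ^ n / omegaVol n)

lemma cc_pos : 0 < cc n := by
  have := omega_pos (n := n)
  unfold cc; positivity

lemma rpow_cast_pred (hn : 1 ≤ n) {x : ℝ} (hx : 0 ≤ x) :
    ENNReal.ofReal x ^ ((n : ℝ) - 1) = ENNReal.ofReal (x ^ (n - 1)) := by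
  have : (n : ℝ) - 1 = ((n - 1 : ℕ) : ℝ) := by rw [Nat.cast_pred hn]
  rw [this, ENNReal.rpow_natCast, ENNReal.ofReal_pow hx]

lemma cell_bound (h : GoodC C R) (hn : 1 ≤ n) {b : Euc n} (hb : b ∈ C) {G : Euc n → ℝ} {δ η : ℝ}
    (hδ : 0 < δ) (hδ2 : δ ≤ 1 / 80) (hη : 0 ≤ η)
    (hcl : ∀ z ∈ hB C b (5 * δ), ‖fderiv ℝ G z - fderiv ℝ G b‖ ≤ η) :
    ENNReal.ofReal (40 * δ) ^ ((n : ℝ) - 1) *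
      ENNReal.ofReal (2 * (5 * δ * (dualNorm C b (fderiv ℝ G b) + 2 * R * η))) ≤
    ENNReal.ofReal (cc n) * ∫⁻ q in hB C b δ,
      ENNReal.ofReal (dualNorm C q (fderiv ℝ G q) + 2 * R * η) ∂hMeasure C := by
  have hR := h.Rpos
  have hω := omega_pos (n := n)
  have hD := dN_nonneg h hb (fderiv ℝ G b)
  set a := dualNorm C b (fderiv ℝ G b) + 2 * R * η with ha
  have ha0 : 0 ≤ a := by positivity
  have step1 : ENNReal.ofReal (40 * δ) ^ ((n : ℝ) - 1) * ENNReal.ofReal (2 * (5 * δ * a)) ≤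
      ENNReal.ofReal (80 ^ n / omegaVol n) *
        (ENNReal.ofReal a * ENNReal.ofReal (omegaVol n / 2 ^ n * δ ^ n)) := by
    rw [rpow_cast_pred hn (by positivity), ← ENNReal.ofReal_mul (by positivity),
      ← ENNReal.ofReal_mul (by positivity), ← ENNReal.ofReal_mul (by positivity)]
    apply ENNReal.ofReal_le_ofReal
    have e1 : 80 ^ n / omegaVol n * (a * (omegaVol n / 2 ^ n * δ ^ n)) = (40 * δ) ^ n * a := by
      rw [show (80 : ℝ) = 40 * 2 by norm_num, mul_pow, mul_pow]
      field_simp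
    rw [e1]
    obtain ⟨m, rfl⟩ : ∃ m, n = m + 1 := ⟨n - 1, by omega⟩
    rw [Nat.add_sub_cancel, pow_succ]
    have : 0 ≤ (40 * δ) ^ m * δ * a := by positivity
    linarith
  have step2 : ENNReal.ofReal a * ENNReal.ofReal (omegaVol n / 2 ^ n * δ ^ n) ≤
      2 * ∫⁻ q in hB C b δ,
        ENNReal.ofReal (dualNorm C q (fderiv ℝ G q) + 2 * R * η) ∂hMeasure C := by
    calc ENNReal.ofReal a * ENNReal.ofReal (omegaVol n / 2 ^ n * δ ^ n)
        ≤ ENNReal.ofReal a * hMeasure C (hB C b δ) := by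
          gcongr
          exact hMeasure_hB h hb hδ (by linarith)
      _ = ∫⁻ q in hB C b δ, ENNReal.ofReal a ∂hMeasure C := by simp
      _ ≤ ∫⁻ q in hB C b δ, 2 *
            ENNReal.ofReal (dualNorm C q (fderiv ℝ G q) + 2 * R * η) ∂hMeasure C := by
          apply setLIntegral_mono' (hB_open h hb δ).measurableSet
          intro q hq
          have e2 : ∀ x : ℝ, 2 * ENNReal.ofReal x = ENNReal.ofReal (2 * x) := by
            intro x
            rw [ENNReal.ofReal_mul (by norm_num), ENNReal.ofReal_ofNat]
          rw [e2]
          apply ENNReal.ofReal_le_ofReal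
          simp only [hB, mem_ofPred_eq] at hq
          obtain ⟨hqC, a1, a2⟩ := fNorm_shift' h hb (q := q) (by linarith)
          have b1 := dN_shift h (p := b) hb hqC (c := 1 / 2) (by norm_num)
            (fun v => by have := a1 v; linarith) (fderiv ℝ G q)
          have b2 := dN_sub h hb (fderiv ℝ G b) (fderiv ℝ G q)
          have b3 := hcl q (by simp only [hB, mem_ofPred_eq]; linarith)
          rw [norm_sub_rev] at b3
          have b4 : 2 * R * ‖fderiv ℝ G b - fderiv ℝ G q‖ ≤ 2 * R * η := by gcongr
          rw [ha]
          linarith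
      _ = _ := by rw [lintegral_const_mul' _ _ (by simp)]
  calc _ ≤ _ := step1
    _ ≤ ENNReal.ofReal (80 ^ n / omegaVol n) * (2 * ∫⁻ q in hB C b δ,
        ENNReal.ofReal (dualNorm C q (fderiv ℝ G q) + 2 * R * η) ∂hMeasure C) := by gcongr
    _ = _ := by
      unfold cc
      rw [ENNReal.ofReal_mul (by norm_num), ENNReal.ofReal_ofNat]
      ring

lemma coarea_step (h : GoodC C R) (hn : 2 ≤ n) {S S' : Set (Euc n)} (hS : S ⊆ C)
    {G : Euc n → ℝ} (hG : Differentiable ℝ G) {δ η : ℝ} (hδ : 0 < δ) (hδ2 : δ ≤ 1 / 80)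
    (hη : 0 ≤ η) (hcl : ∀ b ∈ S, hB C b (5 * δ) ⊆ S' ∧
      ∀ z ∈ hB C b (5 * δ), ‖fderiv ℝ G z - fderiv ℝ G b‖ ≤ η) :
    ∃ Ψ : ℝ → ℝ≥0∞, Measurable Ψ ∧
      (∀ t, ∃ U : ℕ → Set (Euc n), S ∩ G ⁻¹' {t} ⊆ ⋃ i, U i ∧
        (∀ i, ediamD (hDist C) (U i) ≤ ENNReal.ofReal (40 * δ)) ∧
        ∑' i, ediamD (hDist C) (U i) ^ ((n : ℝ) - 1) ≤ Ψ t) ∧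
      ∫⁻ t, Ψ t ≤ ENNReal.ofReal (cc n) * ∫⁻ q in S',
        ENNReal.ofReal (dualNorm C q (fderiv ℝ G q) + 2 * R * η) ∂hMeasure C := by
  obtain ⟨u, huS, huc, hud, hcov⟩ := cover_exists h hS hδ hδ2
  have : Countable u := huc.to_subtype
  have : Encodable u := Encodable.ofCountable u
  have hk : (0 : ℝ) < (n : ℝ) - 1 := by
    have : (2 : ℝ) ≤ n := by exact_mod_cast hn
    linarith
  set rad : Euc n → ℝ := fun b => 5 * δ * (dualNorm C b (fderiv ℝ G b) + 2 * R * η) with hrad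
  set Ψ : ℝ → ℝ≥0∞ := fun t => ∑' b : u, (Metric.closedBall (G b) (rad b)).indicator
    (fun _ => ENNReal.ofReal (40 * δ) ^ ((n : ℝ) - 1)) t with hΨ
  refine ⟨Ψ, ?_, ?_, ?_⟩
  · apply Measurable.tsum
    intro b
    exact measurable_const.indicator Metric.isClosed_closedBall.measurableSet
  · intro t
    set V : u → Set (Euc n) := fun b => hB C b (5 * δ) ∩ G ⁻¹' {t} with hV
    have hVd : ∀ b : u, ediamD (hDist C) (V b) ≤ ENNReal.ofReal (40 * δ) := fun b =>
      hB_ediam h (hS (huS b.2)) hδ2 inter_subset_left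
    refine ⟨fun i => ⋃ b ∈ Encodable.decode₂ u i, V b, ?_, ?_, ?_⟩
    · rw [Encodable.iUnion_decode₂]
      rintro x ⟨hx1, hx2⟩
      obtain ⟨b, hb, hxb⟩ := mem_iUnion₂.1 (hcov hx1)
      exact mem_iUnion.2 ⟨⟨b, hb⟩, hxb, hx2⟩
    · intro i
      refine iSup₂_le fun x hx => iSup₂_le fun y hy => ?_
      obtain ⟨b, hb, hxb⟩ := mem_iUnion₂.1 hx
      obtain ⟨b', hb', hyb⟩ := mem_iUnion₂.1 hy
      have e := Option.mem_unique hb hb'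
      subst e
      exact ENNReal.ofReal_le_ofReal (hB_hDist h (hS (huS b.2)) hδ2 hxb.1 hyb.1)
    · rw [tsum_iUnion_decode₂ (fun s => ediamD (hDist C) s ^ ((n : ℝ) - 1))
        (by simp only [ediamD_empty]; exact ENNReal.zero_rpow_of_pos hk)]
      apply ENNReal.tsum_le_tsum
      intro b
      by_cases ht : t ∈ Metric.closedBall (G b) (rad b)
      · rw [indicator_of_mem ht]
        exact ENNReal.rpow_le_rpow (hVd b) hk.le
      · rw [indicator_of_notMem ht]
        have : V b = ∅ := by
          by_contra hne
          obtain ⟨x, hx1, hx2⟩ := nonempty_iff_ne_empty.2 hne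
          apply ht
          rw [Metric.mem_closedBall, Real.dist_eq, ← (hx2 : G x = t)]
          exact osc_le h (hS (huS b.2)) (by positivity) hη hG (hcl b (huS b.2)).2 hx1
        rw [this, ediamD_empty, ENNReal.zero_rpow_of_pos hk]
  · rw [lintegral_tsum]
    swap
    · intro b
      exact (measurable_const.indicator Metric.isClosed_closedBall.measurableSet).aemeasurable
    calc ∑' b : u, ∫⁻ t, (Metric.closedBall (G b) (rad b)).indicator
            (fun _ => ENNReal.ofReal (40 * δ) ^ ((n : ℝ) - 1)) t
        = ∑' b : u, ENNReal.ofReal (40 * δ) ^ ((n : ℝ) - 1) * ENNReal.ofReal (2 * rad b) := by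
          congr 1; ext b
          rw [lintegral_indicator Metric.isClosed_closedBall.measurableSet]
          simp [Real.volume_closedBall]
      _ ≤ ∑' b : u, ENNReal.ofReal (cc n) * ∫⁻ q in hB C b δ,
            ENNReal.ofReal (dualNorm C q (fderiv ℝ G q) + 2 * R * η) ∂hMeasure C := by
          apply ENNReal.tsum_le_tsum
          intro b
          exact cell_bound h (by omega) (hS (huS b.2)) hδ hδ2 hη (hcl b (huS b.2)).2
      _ = ENNReal.ofReal (cc n) * ∫⁻ q in ⋃ b : u, hB C b δ,
            ENNReal.ofReal (dualNorm C q (fderiv ℝ G q) + 2 * R * η) ∂hMeasure C := by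
          rw [ENNReal.tsum_mul_left, lintegral_iUnion]
          · intro b
            exact (hB_open h (hS (huS b.2)) δ).measurableSet
          · intro b c hbc
            exact hud b.2 c.2 (fun hh => hbc (Subtype.ext hh))
      _ ≤ _ := by
          gcongr
          apply iUnion_subset
          intro b
          refine Subset.trans ?_ (hcl b (huS b.2)).1
          intro q hq
          simp only [hB, mem_ofPred_eq] at *
          linarith

lemma coarea_ineq (h : GoodC C R) (hn : 2 ≤ n) {S S' : Set (Euc n)} (hSc : IsCompact S)
    (hSc' : IsCompact S') (hS' : S' ⊆ C) (hSS : S ⊆ interior S')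
    {G : Euc n → ℝ} (hG : ContDiff ℝ 1 G) :
    ∫⁻ t, hausD ((n : ℝ) - 1) (hDist C) (S ∩ G ⁻¹' {t}) ≤
      ENNReal.ofReal (cc n) * ∫⁻ q in S',
        ENNReal.ofReal (dualNorm C q (fderiv ℝ G q)) ∂hMeasure C := by
  have hR := h.Rpos
  have hSC : S ⊆ C := hSS.trans (interior_subset.trans hS')
  obtain ⟨r, hr, hrS⟩ := hSc.exists_thickening_subset_open isOpen_interior hSS
  have hdG : Continuous (fderiv ℝ G) := hG.continuous_fderiv (by norm_num)
  have huc := hSc'.uniformContinuousOn_of_continuous hdG.continuousOn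
  rw [Metric.uniformContinuousOn_iff] at huc
  have key : ∀ j : ℕ, ∃ δ : ℝ, 0 < δ ∧ δ ≤ 1 / 80 ∧ δ ≤ 1 / ((j : ℝ) + 1) ∧
      (∀ b ∈ S, hB C b (5 * δ) ⊆ S' ∧
      ∀ z ∈ hB C b (5 * δ), ‖fderiv ℝ G z - fderiv ℝ G b‖ ≤ 1 / ((j : ℝ) + 1)) := by
    intro j
    have hj : 0 < 1 / ((j : ℝ) + 1) := by positivity
    obtain ⟨ρ, hρ, hρ2⟩ := huc _ hj
    refine ⟨min (min (1 / 80) (1 / ((j : ℝ) + 1))) (min (r / (10 * R)) (ρ / (10 * R))),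
      by positivity, (min_le_left _ _).trans (min_le_left _ _),
      (min_le_left _ _).trans (min_le_right _ _), ?_⟩
    set δ := min (min (1 / 80) (1 / ((j : ℝ) + 1))) (min (r / (10 * R)) (ρ / (10 * R))) with hδ
    have d1 : δ ≤ r / (10 * R) := (min_le_right _ _).trans (min_le_left _ _)
    have d2 : δ ≤ ρ / (10 * R) := (min_le_right _ _).trans (min_le_right _ _)
    rw [le_div_iff₀ (by positivity)] at d1 d2
    intro b hb
    have hdist : ∀ z ∈ hB C b (5 * δ), dist z b < min r ρ := by
      intro z hz
      simp only [hB, mem_ofPred_eq] at hz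
      have := norm_le_fNorm h (hSC hb) (z - b)
      rw [dist_eq_norm, lt_min_iff]
      constructor <;> nlinarith
    have hsub : hB C b (5 * δ) ⊆ S' := by
      intro z hz
      apply interior_subset
      apply hrS
      rw [Metric.mem_thickening_iff]
      exact ⟨b, hb, (hdist z hz).trans_le (min_le_left _ _)⟩
    refine ⟨hsub, fun z hz => ?_⟩
    have := hρ2 z (hsub hz) b (interior_subset (hSS hb))
      ((hdist z hz).trans_le (min_le_right _ _))
    rw [dist_eq_norm] at this
    exact this.le
  choose δ hδ1 hδ2 hδ3 hδ4 using key
  choose Ψ hΨm hΨc hΨi using fun j : ℕ => coarea_step h hn hSC (hG.differentiable (by norm_num))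
    (hδ1 j) (hδ2 j) (by positivity : (0 : ℝ) ≤ 1 / ((j : ℝ) + 1)) (hδ4 j)
  have hδ0 : Tendsto (fun j => ENNReal.ofReal (40 * δ j)) atTop (nhds 0) := by
    have h1 : Tendsto δ atTop (nhds 0) :=
      squeeze_zero (fun j => (hδ1 j).le) hδ3 tendsto_one_div_add_atTop_nhds_zero_nat
    have h2 := ENNReal.tendsto_ofReal (h1.const_mul 40)
    simpa using h2
  have hm : hMeasure C S' < ⊤ := hMeasure_compact h hSc' hS'
  calc ∫⁻ t, hausD ((n : ℝ) - 1) (hDist C) (S ∩ G ⁻¹' {t})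
      ≤ ∫⁻ t, liminf (fun j => Ψ j t) atTop :=
        lintegral_mono fun t => hausD_le_liminf hδ0 fun j => hΨc j t
    _ ≤ liminf (fun j => ∫⁻ t, Ψ j t) atTop := lintegral_liminf_le hΨm
    _ ≤ liminf (fun j : ℕ => ENNReal.ofReal (cc n) * (∫⁻ q in S',
        ENNReal.ofReal (dualNorm C q (fderiv ℝ G q)) ∂hMeasure C +
          ENNReal.ofReal (2 * R * (1 / ((j : ℝ) + 1))) * hMeasure C S')) atTop := by
        refine liminf_le_liminf (Eventually.of_forall fun j => ?_)
        refine (hΨi j).trans ?_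
        gcongr
        calc _ ≤ ∫⁻ q in S', (ENNReal.ofReal (dualNorm C q (fderiv ℝ G q)) +
              ENNReal.ofReal (2 * R * (1 / ((j : ℝ) + 1)))) ∂hMeasure C :=
              lintegral_mono fun q => ENNReal.ofReal_add_le
          _ = _ := by rw [lintegral_add_right _ measurable_const]; simp
    _ = _ := by
        apply Tendsto.liminf_eq
        apply ENNReal.Tendsto.const_mul _ (Or.inr ENNReal.ofReal_ne_top)
        have h1 : Tendsto (fun j : ℕ => ENNReal.ofReal (2 * R * (1 / ((j : ℝ) + 1)))) atTop
            (nhds 0) := by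
          have h2 := ENNReal.tendsto_ofReal
            (tendsto_one_div_add_atTop_nhds_zero_nat (𝕜 := ℝ) |>.const_mul (2 * R))
          simpa using h2
        have h2 := ENNReal.Tendsto.mul_const h1 (b := hMeasure C S') (Or.inr hm.ne)
        rw [zero_mul] at h2
        simpa using (tendsto_const_nhds (x := ∫⁻ q in S',
          ENNReal.ofReal (dualNorm C q (fderiv ℝ G q)) ∂hMeasure C)).add h2

end coarea
section sard
variable {n : ℕ} {C : Set (Euc n)} {R : ℝ} {p : Euc n}

lemma sard_perturb {F : Euc n → ℝ} (hF : ContDiff ℝ 2 F) {η : ℝ} (hη : 0 < η) :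
    ∃ v : Euc n, ‖v‖ < η ∧ {x | fderiv ℝ F x + innerSL ℝ v = 0}.Countable := by
  set φ : Euc n → Euc n := fun x => (InnerProductSpace.toDual ℝ (Euc n)).symm (fderiv ℝ F x) with hφ
  have hφd : Differentiable ℝ φ := by
    have h1 : ContDiff ℝ 1 (fderiv ℝ F) := hF.fderiv_right (by norm_num)
    have h2 := h1.differentiable (by norm_num)
    exact (InnerProductSpace.toDual ℝ (Euc n)).symm.toContinuousLinearEquiv.differentiable.comp h2
  set Cr : Set (Euc n) := {x | (fderiv ℝ φ x).det = 0} with hCr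
  have hnull : volume (φ '' Cr) = 0 :=
    addHaar_image_eq_zero_of_det_fderivWithin_eq_zero volume (f' := fderiv ℝ φ)
      (fun x _ => (hφd x).hasFDerivAt.hasFDerivWithinAt) (fun x hx => hx)
  have hex : ∃ w ∈ Metric.ball (0 : Euc n) η, w ∉ φ '' Cr := by
    by_contra hcon
    push Not at hcon
    have h1 : volume (Metric.ball (0 : Euc n) η) ≤ 0 := hnull ▸ measure_mono hcon
    exact (Metric.measure_ball_pos volume (0 : Euc n) hη).not_ge h1
  obtain ⟨w, hw1, hw2⟩ := hex
  refine ⟨-w, by simpa using hw1, ?_⟩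
  have hZ : {x | fderiv ℝ F x + innerSL ℝ (-w) = 0} = {x | φ x = w} := by
    ext x
    simp only [mem_ofPred_eq, hφ]
    rw [LinearIsometryEquiv.symm_apply_eq, map_neg, ← sub_eq_add_neg, sub_eq_zero]
    rfl
  rw [hZ]
  have hiso : ∀ x ∈ {x | φ x = w}, ({x} : Set (Euc n)) ∈ nhdsWithin x {x | φ x = w} := by
    intro x hx
    have hdet : (fderiv ℝ φ x).det ≠ 0 := fun h0 => hw2 ⟨x, h0, hx⟩
    have h1 := (hφd x).hasFDerivAt.eventually_ne (c := w)
      ⟨_, (by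
        have := ((fderiv ℝ φ x).toContinuousLinearEquivOfDetNeZero hdet).antilipschitz
        exact this)⟩
    rw [eventually_nhdsWithin_iff] at h1
    rw [mem_nhdsWithin_iff_eventually]
    filter_upwards [h1] with z hz hzZ
    by_contra hne
    exact hz hne hzZ
  obtain ⟨t, _, ht2, ht3⟩ := TopologicalSpace.countable_cover_nhdsWithin hiso
  apply ht2.mono
  simpa using ht3

lemma hausD_mono {α : Type*} {k : ℝ} {d : α → α → ℝ} {S T : Set α} (hST : S ⊆ T) :
    hausD k d S ≤ hausD k d T := by
  unfold hausD
  refine iSup₂_mono fun ε hε => ?_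
  refine le_iInf fun U => le_iInf fun h1 => le_iInf fun h2 => ?_
  exact (iInf₂_le U (hST.trans h1)).trans (iInf_le _ h2)

lemma cheeger_bdd (C Ω : Set (Euc n)) :
    BddBelow {r : ℝ | ∃ U : Set (Euc n), IsOpen U ∧ U.Nonempty ∧ closure U ⊆ Ω ∧
    IsC1Hypersurface (frontier U) ∧
    r = (hausD ((n : ℝ) - 1) (hDist C) (frontier U)).toReal / (hMeasure C U).toReal} := by
  refine ⟨0, ?_⟩
  rintro r ⟨U, _, _, _, _, rfl⟩
  positivity

lemma cheeger_nonneg (C Ω : Set (Euc n)) : 0 ≤ cheegerND C Ω := by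
  apply Real.sInf_nonneg
  rintro r ⟨U, _, _, _, _, rfl⟩
  positivity

lemma cheeger_level (h : GoodC C R) {Ω S : Set (Euc n)} (hS : IsCompact S) (hSΩ : S ⊆ Ω)
    (hΩ : Ω ⊆ C) {G : Euc n → ℝ} (hG : ContDiff ℝ 1 G) {t : ℝ}
    (hreg : ∀ x, G x = t → fderiv ℝ G x ≠ 0) (hsub : ∀ x ∈ C, t ≤ G x → x ∈ S) :
    ENNReal.ofReal (cheegerND C Ω) * hMeasure C (C ∩ {x | t < G x}) ≤
      hausD ((n : ℝ) - 1) (hDist C) (S ∩ G ⁻¹' {t}) := by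
  set U : Set (Euc n) := C ∩ {x | t < G x} with hU
  have hUo : IsOpen U := h.op.inter (isOpen_lt continuous_const hG.continuous)
  have hUS : U ⊆ S := fun x hx => hsub x hx.1 (le_of_lt hx.2)
  have hclS : closure U ⊆ S := closure_minimal hUS hS.isClosed
  have hfr : frontier U ⊆ S ∩ G ⁻¹' {t} := by
    intro x hx
    rw [hUo.frontier_eq] at hx
    have hxS := hclS hx.1
    refine ⟨hxS, ?_⟩
    have h1 : t ≤ G x := by
      have : closure U ⊆ {x | t ≤ G x} :=
        closure_minimal (fun y hy => (le_of_lt hy.2 : t ≤ G y)) (isClosed_le continuous_const hG.continuous)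
      exact this hx.1
    have h2 : ¬ t < G x := fun hh => hx.2 ⟨hΩ (hSΩ hxS), hh⟩
    exact le_antisymm (not_lt.1 h2) h1
  rcases U.eq_empty_or_nonempty with hemp | hne
  · rw [hemp]; simp
  have hC1 : IsC1Hypersurface (frontier U) := by
    intro x hx
    have hxS := hfr hx
    refine ⟨fun y => G y - t, C ∩ {y | fderiv ℝ G y ≠ 0}, ?_, ?_, ?_, ?_⟩
    · apply IsOpen.mem_nhds
      · exact h.op.inter (isOpen_ne_fun (hG.continuous_fderiv (by norm_num)) continuous_const)
      · exact ⟨hΩ (hSΩ hxS.1), hreg x hxS.2⟩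
    · exact (hG.sub contDiff_const).contDiffOn
    · intro y hy
      rw [fderiv_sub_const]
      exact hy.2
    · ext y
      constructor
      · rintro ⟨hy1, hy2⟩
        refine ⟨hy2, ?_⟩
        have := (hfr hy1).2
        rw [mem_preimage, mem_singleton_iff] at this
        simp [this]
      · rintro ⟨hy2, hy3⟩
        refine ⟨?_, hy2⟩
        have hyt : G y = t := by
          have : G y - t = 0 := hy3
          linarith
        rw [hUo.frontier_eq]
        refine ⟨?_, fun hh => by have := hh.2; simp [hyt] at this⟩
        by_contra hcl
        apply hy2.2
        apply IsLocalMax.fderiv_eq_zero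
        have h1 : ∀ᶠ z in nhds y, z ∉ closure U :=
          isClosed_closure.isOpen_compl.mem_nhds hcl
        filter_upwards [h1, h.op.mem_nhds hy2.1] with z hz1 hz2
        rw [hyt]
        by_contra hz3
        exact hz1 (subset_closure ⟨hz2, not_le.1 hz3⟩)
  refine le_trans ?_ (hausD_mono hfr)
  have hI : cheegerND C Ω ≤ (hausD ((n : ℝ) - 1) (hDist C) (frontier U)).toReal /
      (hMeasure C U).toReal :=
    csInf_le (cheeger_bdd C Ω) ⟨U, hUo, hne, hclS.trans hSΩ, hC1, rfl⟩
  by_cases htop : hausD ((n : ℝ) - 1) (hDist C) (frontier U) = ⊤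
  · rw [htop]; exact le_top
  have hμ : hMeasure C U < ⊤ :=
    (measure_mono hUS).trans_lt (hMeasure_compact h hS (hSΩ.trans hΩ))
  by_cases h0 : hMeasure C U = 0
  · rw [h0]; simp
  have hpos := ENNReal.toReal_pos h0 hμ.ne
  rw [le_div_iff₀ hpos] at hI
  have := ENNReal.ofReal_le_ofReal hI
  rwa [ENNReal.ofReal_mul (cheeger_nonneg C Ω), ENNReal.ofReal_toReal hμ.ne,
    ENNReal.ofReal_toReal htop] at this

lemma cheeger_L1_pert (h : GoodC C R) (hn : 2 ≤ n) {Ω S' : Set (Euc n)}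
    (hΩ : Ω ⊆ C) {F : Euc n → ℝ} (hF : ContDiff ℝ 2 F) (hF0 : ∀ x, 0 ≤ F x)
    (hFc : HasCompactSupport F) (hFΩ : tsupport F ⊆ Ω) (hS' : IsCompact S')
    (hSS : tsupport F ⊆ interior S') (hS'C : S' ⊆ C) {η : ℝ} (hη : 0 < η) :
    ENNReal.ofReal (cheegerND C Ω) * ∫⁻ q, ENNReal.ofReal (F q) ∂hMeasure C ≤
      ENNReal.ofReal (cc n) * ∫⁻ q in S',
        ENNReal.ofReal (dualNorm C q (fderiv ℝ F q)) ∂hMeasure C +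
      ENNReal.ofReal (2 * R * η) * (ENNReal.ofReal (cheegerND C Ω) * hMeasure C (tsupport F) +
        ENNReal.ofReal (cc n) * hMeasure C S') := by
  have hR := h.Rpos
  set I := ENNReal.ofReal (cheegerND C Ω) with hI
  obtain ⟨v, hv, hZ⟩ := sard_perturb hF hη
  set G : Euc n → ℝ := fun x => F x + (innerSL ℝ v x + η * R) with hGdef
  have hFd : Differentiable ℝ F := hF.differentiable (by norm_num)
  have hG : ContDiff ℝ 1 G :=
    (hF.of_le (by norm_num)).add ((innerSL ℝ v).contDiff.add contDiff_const)
  have hGf : ∀ x, fderiv ℝ G x = fderiv ℝ F x + innerSL ℝ v := by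
    intro x
    exact ((hFd x).hasFDerivAt.add ((innerSL ℝ v).hasFDerivAt.add_const _)).fderiv
  have hin : ∀ x ∈ C, |innerSL ℝ v x| ≤ η * R := by
    intro x hx
    rw [innerSL_apply_apply]
    refine (abs_real_inner_le_norm v x).trans ?_
    have := h.bd x hx
    gcongr
  have hcrit : ∀ᵐ t : ℝ, ∀ x, G x = t → fderiv ℝ G x ≠ 0 := by
    have h1 : (G '' {x | fderiv ℝ F x + innerSL ℝ v = 0}).Countable := hZ.image G
    have h2 : volume (G '' {x | fderiv ℝ F x + innerSL ℝ v = 0}) = 0 := h1.measure_zero _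
    filter_upwards [measure_eq_zero_iff_ae_notMem.1 h2] with t ht x hx hx0
    rw [hGf] at hx0
    exact ht ⟨x, hx0, hx⟩
  have hlev : ∀ᵐ t ∂(volume.restrict (Ioi (2 * R * η))),
      I * hMeasure C {x | t < F x} ≤
        hausD ((n : ℝ) - 1) (hDist C) (tsupport F ∩ G ⁻¹' {t}) := by
    rw [ae_restrict_iff' measurableSet_Ioi]
    filter_upwards [hcrit] with t ht htR
    have htR' : 2 * R * η < t := htR
    refine le_trans ?_ (cheeger_level h hFc hFΩ hΩ hG ht ?_)
    · gcongr
      intro x hx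
      have hxF : t < F x := hx
      have : 0 < F x := lt_trans (by positivity) (htR'.trans hxF)
      have hxC : x ∈ C := hΩ (hFΩ (subset_tsupport F this.ne'))
      refine ⟨hxC, ?_⟩
      have := abs_le.1 (hin x hxC)
      simp only [hGdef, mem_ofPred_eq]
      linarith
    · intro x hxC hx
      have := abs_le.1 (hin x hxC)
      simp only [hGdef] at hx
      apply subset_tsupport F
      have : 0 < F x := by linarith
      exact this.ne'
  have hco := coarea_ineq h hn hFc hS' hS'C hSS hG
  have hlayer := lintegral_eq_lintegral_meas_lt (hMeasure C) (Eventually.of_forall hF0)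
    hF.continuous.measurable.aemeasurable
  have hsplit : ∫⁻ t in Ioi 0, hMeasure C {a | t < F a} ≤
      ENNReal.ofReal (2 * R * η) * hMeasure C (tsupport F) +
        ∫⁻ t in Ioi (2 * R * η), hMeasure C {a | t < F a} := by
    rw [← Ioc_union_Ioi_eq_Ioi (show (0 : ℝ) ≤ 2 * R * η by positivity)]
    refine (lintegral_union_le _ _ _).trans ?_
    gcongr
    calc ∫⁻ t in Ioc 0 (2 * R * η), hMeasure C {a | t < F a}
        ≤ ∫⁻ t in Ioc 0 (2 * R * η), hMeasure C (tsupport F) := by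
          apply setLIntegral_mono' measurableSet_Ioc
          intro t ht
          apply measure_mono
          intro x hx
          have : 0 < F x := lt_trans ht.1 hx
          exact subset_tsupport F this.ne'
      _ = _ := by simp [mul_comm]
  have hmain : I * ∫⁻ t in Ioi (2 * R * η), hMeasure C {a | t < F a} ≤
      ENNReal.ofReal (cc n) * (∫⁻ q in S',
        ENNReal.ofReal (dualNorm C q (fderiv ℝ F q)) ∂hMeasure C +
        ENNReal.ofReal (2 * R * η) * hMeasure C S') := by
    calc I * ∫⁻ t in Ioi (2 * R * η), hMeasure C {a | t < F a}
        = ∫⁻ t in Ioi (2 * R * η), I * hMeasure C {a | t < F a} := by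
          rw [lintegral_const_mul' _ _ ENNReal.ofReal_ne_top]
      _ ≤ ∫⁻ t in Ioi (2 * R * η), hausD ((n : ℝ) - 1) (hDist C) (tsupport F ∩ G ⁻¹' {t}) :=
          lintegral_mono_ae hlev
      _ ≤ ∫⁻ t, hausD ((n : ℝ) - 1) (hDist C) (tsupport F ∩ G ⁻¹' {t}) :=
          setLIntegral_le_lintegral _ _
      _ ≤ _ := hco
      _ ≤ _ := by
          gcongr
          calc _ ≤ ∫⁻ q in S', (ENNReal.ofReal (dualNorm C q (fderiv ℝ F q)) +
                ENNReal.ofReal (2 * R * η)) ∂hMeasure C := by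
                apply setLIntegral_mono' hS'.measurableSet
                intro q hq
                refine le_trans (ENNReal.ofReal_le_ofReal ?_) ENNReal.ofReal_add_le
                have h1 := dN_add h (hS'C hq) (fderiv ℝ F q) (innerSL ℝ v)
                have h2 := dN_le_norm h (hS'C hq) (innerSL ℝ v)
                rw [innerSL_apply_norm] at h2
                rw [hGf]
                have : 2 * R * ‖v‖ ≤ 2 * R * η := by gcongr
                linarith
            _ = _ := by rw [lintegral_add_right _ measurable_const]; simp
  rw [hlayer]
  calc _ ≤ I * (ENNReal.ofReal (2 * R * η) * hMeasure C (tsupport F) +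
        ∫⁻ t in Ioi (2 * R * η), hMeasure C {a | t < F a}) := by gcongr
    _ = I * (ENNReal.ofReal (2 * R * η) * hMeasure C (tsupport F)) +
        I * ∫⁻ t in Ioi (2 * R * η), hMeasure C {a | t < F a} := mul_add _ _ _
    _ ≤ I * (ENNReal.ofReal (2 * R * η) * hMeasure C (tsupport F)) +
      ENNReal.ofReal (cc n) * (∫⁻ q in S',
        ENNReal.ofReal (dualNorm C q (fderiv ℝ F q)) ∂hMeasure C +
        ENNReal.ofReal (2 * R * η) * hMeasure C S') := by gcongr
    _ = _ := by ring

lemma cheeger_L1 (h : GoodC C R) (hn : 2 ≤ n) {Ω S' : Set (Euc n)}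
    (hΩ : Ω ⊆ C) {F : Euc n → ℝ} (hF : ContDiff ℝ 2 F) (hF0 : ∀ x, 0 ≤ F x)
    (hFc : HasCompactSupport F) (hFΩ : tsupport F ⊆ Ω) (hS' : IsCompact S')
    (hSS : tsupport F ⊆ interior S') (hS'C : S' ⊆ C) :
    ENNReal.ofReal (cheegerND C Ω) * ∫⁻ q, ENNReal.ofReal (F q) ∂hMeasure C ≤
      ENNReal.ofReal (cc n) * ∫⁻ q in S',
        ENNReal.ofReal (dualNorm C q (fderiv ℝ F q)) ∂hMeasure C := by
  set X := ENNReal.ofReal (cc n) * ∫⁻ q in S',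
        ENNReal.ofReal (dualNorm C q (fderiv ℝ F q)) ∂hMeasure C with hX
  set Y := (ENNReal.ofReal (cheegerND C Ω) * hMeasure C (tsupport F) +
        ENNReal.ofReal (cc n) * hMeasure C S') with hY
  have hYf : Y ≠ ⊤ := by
    have h1 := hMeasure_compact h hFc (hFΩ.trans hΩ)
    have h2 := hMeasure_compact h hS' hS'C
    exact ENNReal.add_ne_top.2 ⟨ENNReal.mul_ne_top ENNReal.ofReal_ne_top h1.ne,
      ENNReal.mul_ne_top ENNReal.ofReal_ne_top h2.ne⟩
  have hlim : Tendsto (fun j : ℕ => X + ENNReal.ofReal (2 * R * (1 / ((j : ℝ) + 1))) * Y) atTop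
      (nhds X) := by
    have h1 : Tendsto (fun j : ℕ => ENNReal.ofReal (2 * R * (1 / ((j : ℝ) + 1)))) atTop
        (nhds 0) := by
      have h2 := ENNReal.tendsto_ofReal
        (tendsto_one_div_add_atTop_nhds_zero_nat (𝕜 := ℝ) |>.const_mul (2 * R))
      simpa using h2
    have h2 := ENNReal.Tendsto.mul_const h1 (b := Y) (Or.inr hYf)
    rw [zero_mul] at h2
    simpa using (tendsto_const_nhds (x := X)).add h2
  refine ge_of_tendsto hlim (Eventually.of_forall fun j => ?_)
  exact cheeger_L1_pert h hn hΩ hF hF0 hFc hFΩ hS' hSS hS'C (by positivity)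

end sard

lemma cheeger_L2_smooth {n : ℕ} {C Ω S' : Set (Euc n)} {R : ℝ} {f : Euc n → ℝ} (h : GoodC C R)
    (hn : 2 ≤ n) (hΩ : Ω ⊆ C) (hf : ContDiff ℝ 2 f) (hfc : HasCompactSupport f)
    (hS' : IsCompact S') (hSS : tsupport f ⊆ interior S') (hS'Ω : S' ⊆ Ω) :
    cheegerND C Ω ^ 2 * ∫ q in S', f q ^ 2 ∂hMeasure C ≤
      4 * cc n ^ 2 * ∫ q in S', dualNorm C q (fderiv ℝ f q) ^ 2 ∂hMeasure C := by
  have hS'C : S' ⊆ C := hS'Ω.trans hΩ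
  set I := cheegerND C Ω with hI
  have hc : 0 < cc n := cc_pos
  set c := cc n
  have hI0 : 0 ≤ I := cheeger_nonneg C Ω
  rcases hI0.eq_or_lt with h0 | hIpos
  · rw [← h0]
    have : 0 ≤ ∫ q in S', dualNorm C q (fderiv ℝ f q) ^ 2 ∂hMeasure C :=
      integral_nonneg fun q => sq_nonneg _
    simp only [ne_eq, OfNat.ofNat_ne_zero, not_false_eq_true, zero_pow, zero_mul]
    positivity
  set μ := (hMeasure C).restrict S' with hμ
  have : IsFiniteMeasure μ := ⟨by
    rw [hμ, Measure.restrict_apply_univ]; exact hMeasure_compact h hS' hS'C⟩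
  have hS'm := hS'.measurableSet
  have hae : ∀ᵐ q ∂μ, q ∈ S' := ae_restrict_mem hS'm
  have hdf : Continuous (fderiv ℝ f) := hf.continuous_fderiv (by norm_num)
  obtain ⟨M, hM⟩ := hS'.exists_bound_of_continuousOn hf.continuous.continuousOn
  obtain ⟨M', hM'⟩ := hS'.exists_bound_of_continuousOn hdf.continuousOn
  have hmD : AEStronglyMeasurable (fun q => dualNorm C q (fderiv ℝ f q)) μ :=
    ((dN_aem h hdf.measurable).mono_measure Measure.restrict_le_self).aestronglyMeasurable
  have hdb : ∀ q ∈ S', dualNorm C q (fderiv ℝ f q) ≤ 2 * R * M' := fun q hq =>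
    (dN_le_norm h (hS'C hq) _).trans
      (mul_le_mul_of_nonneg_left (hM' q hq) (by have := h.Rpos; positivity))
  have if2 : Integrable (fun q => f q ^ 2) μ := by
    refine Integrable.of_bound (hf.continuous.pow 2).aestronglyMeasurable (M ^ 2) ?_
    filter_upwards [hae] with q hq
    rw [norm_pow]
    exact pow_le_pow_left₀ (norm_nonneg _) (hM q hq) 2
  have ih2 : Integrable (fun q => dualNorm C q (fderiv ℝ f q) ^ 2) μ := by
    refine Integrable.of_bound (hmD.pow 2) ((2 * R * M') ^ 2) ?_
    filter_upwards [hae] with q hq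
    rw [norm_pow, Real.norm_eq_abs, abs_of_nonneg (dN_nonneg h (hS'C hq) _)]
    exact pow_le_pow_left₀ (dN_nonneg h (hS'C hq) _) (hdb q hq) 2
  have hsub : tsupport (fun x => f x ^ 2) ⊆ tsupport f := by
    apply closure_mono
    intro x hx hx0
    apply hx
    show f x ^ 2 = 0
    rw [hx0]; norm_num
  have key := cheeger_L1 (F := fun x => f x ^ 2) (S' := S') h hn hΩ (hf.pow 2)
    (fun x => sq_nonneg _)
    (hfc.mono' (subset_trans subset_closure hsub))
    (hsub.trans (hSS.trans (interior_subset.trans hS'Ω)))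
    hS' (hsub.trans hSS) hS'C
  have hfd : ∀ q, fderiv ℝ (fun x => f x ^ 2) q = (2 * f q) • fderiv ℝ f q := by
    intro q
    have := ((hf.differentiable (by norm_num)) q).hasFDerivAt.pow 2
    rw [this.fderiv]; simp
  have l1 : ENNReal.ofReal I * ∫⁻ q, ENNReal.ofReal (f q ^ 2) ∂μ ≤
      ENNReal.ofReal c * ∫⁻ q, ENNReal.ofReal
        (2 * |f q| * dualNorm C q (fderiv ℝ f q)) ∂μ := by
    refine le_trans (mul_le_mul_right (lintegral_mono' Measure.restrict_le_self le_rfl) _) (key.trans ?_)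
    refine mul_le_mul_right ?_ _
    apply lintegral_mono_ae
    filter_upwards [hae] with q hq
    apply ENNReal.ofReal_le_ofReal
    rw [hfd]
    refine (dN_smul_le h (hS'C hq) _ _).trans_eq ?_
    rw [abs_mul]; norm_num
  rw [← lintegral_const_mul' _ _ ENNReal.ofReal_ne_top,
    ← lintegral_const_mul' _ _ ENNReal.ofReal_ne_top] at l1
  have l2 : ∫⁻ q, ENNReal.ofReal (I * f q ^ 2) ∂μ ≤ ∫⁻ q, ENNReal.ofReal
      (I / 2 * f q ^ 2 + 2 * c ^ 2 / I * dualNorm C q (fderiv ℝ f q) ^ 2) ∂μ := by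
    refine le_trans (le_of_eq ?_) (l1.trans ?_)
    · congr 1; ext q; rw [ENNReal.ofReal_mul hI0]
    · apply lintegral_mono
      intro q
      dsimp only
      rw [← ENNReal.ofReal_mul hc.le]
      apply ENNReal.ofReal_le_ofReal
      set d := dualNorm C q (fderiv ℝ f q)
      have e : I / 2 * f q ^ 2 + 2 * c ^ 2 / I * d ^ 2 - c * (2 * |f q| * d) =
          (I * |f q| - 2 * c * d) ^ 2 / (2 * I) := by
        rw [← sq_abs (f q)]; field_simp; ring
      have : 0 ≤ (I * |f q| - 2 * c * d) ^ 2 / (2 * I) := by positivity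
      linarith
  have ir : Integrable (fun q => I / 2 * f q ^ 2 +
      2 * c ^ 2 / I * dualNorm C q (fderiv ℝ f q) ^ 2) μ :=
    (if2.const_mul _).add (ih2.const_mul _)
  rw [← ofReal_integral_eq_lintegral_ofReal (if2.const_mul I)
      (Eventually.of_forall fun q => by positivity),
    ← ofReal_integral_eq_lintegral_ofReal ir (Eventually.of_forall fun q => by positivity),
    ENNReal.ofReal_le_ofReal_iff (integral_nonneg fun q => by positivity),
    integral_add (if2.const_mul _) (ih2.const_mul _), integral_const_mul, integral_const_mul,
    integral_const_mul] at l2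
  set A := ∫ q, f q ^ 2 ∂μ
  set B := ∫ q, dualNorm C q (fderiv ℝ f q) ^ 2 ∂μ
  have l3 : I / 2 * A ≤ 2 * c ^ 2 / I * B := by linarith
  have l4 := mul_le_mul_of_nonneg_left l3 (show (0:ℝ) ≤ 2 * I by positivity)
  have e1 : 2 * I * (I / 2 * A) = I ^ 2 * A := by ring
  have e2 : 2 * I * (2 * c ^ 2 / I * B) = 4 * c ^ 2 * B := by field_simp; ring
  linarith

open Convolution in
lemma mollify {n : ℕ} {f : Euc n → ℝ} {K : ℝ≥0} (hf : LipschitzWith K f)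
    (hfc : HasCompactSupport f) {O : Set (Euc n)} (hO : IsOpen O) (hfO : tsupport f ⊆ O) :
    ∃ (g : ℕ → Euc n → ℝ) (M : ℝ), (∀ᶠ j in atTop, ContDiff ℝ 2 (g j) ∧ HasCompactSupport (g j) ∧
      tsupport (g j) ⊆ O) ∧ (∀ j x, |g j x| ≤ M) ∧ (∀ j x, ‖fderiv ℝ (g j) x‖ ≤ K) ∧
      (∀ x, Tendsto (fun j => g j x) atTop (nhds (f x))) ∧
      ∀ᵐ x, Tendsto (fun j => fderiv ℝ (g j) x) atTop (nhds (fderiv ℝ f x)) := by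
  let φ : ℕ → ContDiffBump (0 : Euc n) := fun j =>
    ⟨1 / ((j : ℝ) + 1), 2 * (1 / ((j : ℝ) + 1)), by positivity, by
      have : (0:ℝ) < 1 / ((j : ℝ) + 1) := by positivity
      linarith⟩
  have hφ : Tendsto (fun j => (φ j).rOut) atTop (nhds 0) := by
    have := (tendsto_one_div_add_atTop_nhds_zero_nat (𝕜 := ℝ)).const_mul 2
    simpa [φ] using this
  have hφK : ∀ j, (φ j).rOut ≤ 2 * (φ j).rIn := fun j => le_rfl
  let g : ℕ → Euc n → ℝ := fun j => ((φ j).normed volume ⋆[ContinuousLinearMap.lsmul ℝ ℝ, volume] f)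
  have hfcont := hf.continuous
  obtain ⟨M, hM⟩ := hfcont.bounded_above_of_compact_support hfc
  have hgx : ∀ j x, g j x = ∫ t, (φ j).normed volume t * f (x - t) := fun j x => rfl
  have hint : ∀ j x, Integrable (fun t => (φ j).normed volume t * f (x - t)) := by
    intro j x
    exact (Continuous.mul (φ j).continuous_normed (hfcont.comp (continuous_const.sub continuous_id))).integrable_of_hasCompactSupport
      ((φ j).hasCompactSupport_normed.mul_right)
  have hn0 : ∀ j t, 0 ≤ (φ j).normed volume t := fun j t => (φ j).nonneg_normed t
  have hni : ∀ j, Integrable ((φ j).normed (volume : Measure (Euc n))) := fun j => (φ j).integrable_normed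
  have hn1 : ∀ j, ∫ t, (φ j).normed (volume : Measure (Euc n)) t = 1 := fun j => (φ j).integral_normed
  have hglip : ∀ j, LipschitzWith K (g j) := by
    intro j
    apply LipschitzWith.of_dist_le_mul
    intro x y
    rw [Real.dist_eq, hgx, hgx, ← integral_sub (hint j x) (hint j y)]
    calc |∫ t, ((φ j).normed volume t * f (x - t) - (φ j).normed volume t * f (y - t))|
        ≤ ∫ t, (φ j).normed volume t * (K * dist x y) := by
          rw [← Real.norm_eq_abs]
          refine norm_integral_le_of_norm_le ((hni j).mul_const _) (Eventually.of_forall fun t => ?_)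
          rw [← mul_sub, norm_mul, Real.norm_eq_abs, abs_of_nonneg (hn0 j t)]
          refine mul_le_mul_of_nonneg_left ?_ (hn0 j t)
          have := hf.dist_le_mul (x - t) (y - t)
          rwa [dist_sub_right, dist_eq_norm] at this
      _ = K * dist x y := by rw [integral_mul_const, hn1, one_mul]
  refine ⟨g, M, ?_, ?_, ?_, ?_, ?_⟩
  · obtain ⟨δ, hδ, hδO⟩ := hfc.isCompact.exists_cthickening_subset_open hO hfO
    filter_upwards [hφ.eventually (gt_mem_nhds hδ)] with j hj
    refine ⟨?_, ?_, ?_⟩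
    · exact (φ j).hasCompactSupport_normed.contDiff_convolution_left _ (φ j).contDiff_normed
        hfcont.locallyIntegrable
    · exact HasCompactSupport.convolution _ (φ j).hasCompactSupport_normed hfc
    · refine subset_trans (closure_minimal ?_ Metric.isClosed_cthickening) hδO
      intro x hx
      by_contra hxn
      apply hx
      rw [hgx]
      apply integral_eq_zero_of_ae
      refine Eventually.of_forall fun t => ?_
      show _ * _ = (0:ℝ)
      by_cases ht : t ∈ Metric.ball (0 : Euc n) (φ j).rOut
      · have : f (x - t) = 0 := by
          by_contra hne
          apply hxn
          refine Metric.mem_cthickening_of_dist_le x (x - t) δ _ (subset_closure hne) ?_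
          rw [dist_eq_norm, sub_sub_cancel]
          rw [mem_ball_zero_iff] at ht
          linarith
        rw [this, mul_zero]
      · rw [← (φ j).support_normed_eq (μ := volume), Function.notMem_support] at ht
        rw [ht, zero_mul]
  · intro j x
    rw [hgx]
    calc |∫ t, (φ j).normed volume t * f (x - t)| ≤ ∫ t, (φ j).normed volume t * M := by
          rw [← Real.norm_eq_abs]
          refine norm_integral_le_of_norm_le ((hni j).mul_const _) (Eventually.of_forall fun t => ?_)
          rw [norm_mul, Real.norm_eq_abs, abs_of_nonneg (hn0 j t)]
          exact mul_le_mul_of_nonneg_left (hM _) (hn0 j t)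
      _ = M := by rw [integral_mul_const, hn1, one_mul]
  · intro j x
    exact norm_fderiv_le_of_lipschitz ℝ (hglip j)
  · intro x
    exact ContDiffBump.convolution_tendsto_right_of_continuous hφ hfcont x
  · have hmeas : Measurable (fderiv ℝ f) := measurable_fderiv ℝ f
    have hloc : LocallyIntegrable (fderiv ℝ f) (volume : Measure (Euc n)) := by
      intro x
      refine ⟨Metric.ball x 1, Metric.ball_mem_nhds x one_pos, ?_⟩
      have : IsFiniteMeasure ((volume : Measure (Euc n)).restrict (Metric.ball x 1)) :=
        ⟨by rw [Measure.restrict_apply_univ]; exact measure_ball_lt_top⟩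
      exact Integrable.of_bound hmeas.aestronglyMeasurable K
        (Eventually.of_forall fun y => norm_fderiv_le_of_lipschitz ℝ hf)
    filter_upwards [ContDiffBump.ae_convolution_tendsto_right_of_locallyIntegrable (φ := φ) (K := 2) hφ
      (Eventually.of_forall hφK) hloc] with x hx
    refine hx.congr fun j => ?_
    symm
    have hdiff : ∀ᵐ t : Euc n, DifferentiableAt ℝ f (x - t) :=
      (quasiMeasurePreserving_sub_left volume x).ae hf.ae_differentiableAt
    have := (hasFDerivAt_integral_of_dominated_loc_of_lip (μ := (volume : Measure (Euc n)))
      (𝕜 := ℝ) (F := fun y t => (φ j).normed volume t * f (y - t)) (x₀ := x) (s := univ)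
      (F' := fun t => (φ j).normed volume t • fderiv ℝ f (x - t))
      (bound := fun t => (φ j).normed volume t * K) univ_mem
      (Eventually.of_forall fun y => (hint j y).aestronglyMeasurable) (hint j x)
      ?_ ?_ ((hni j).mul_const _) ?_).2
    · exact this.fderiv
    · exact ((φ j).continuous_normed.measurable.smul
        (hmeas.comp (measurable_const.sub measurable_id))).aestronglyMeasurable
    · refine Eventually.of_forall fun t => LipschitzOnWith.of_dist_le_mul fun y _ z _ => ?_
      have := hf.dist_le_mul (y - t) (z - t)
      rw [dist_sub_right] at this
      rw [Real.dist_eq] at this ⊢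
      rw [← mul_sub, abs_mul, abs_of_nonneg (hn0 j t)]
      have e : ((Real.nnabs ((φ j).normed volume t * K) : ℝ≥0) : ℝ) = (φ j).normed volume t * K := by
        rw [Real.coe_nnabs]; exact abs_of_nonneg (mul_nonneg (hn0 j t) K.coe_nonneg)
      rw [e, mul_assoc]
      exact mul_le_mul_of_nonneg_left this (hn0 j t)
    · filter_upwards [hdiff] with t ht
      have h1 : HasFDerivAt (fun y => f (y - t)) (fderiv ℝ f (x - t)) x := by
        have := ht.hasFDerivAt.comp x ((hasFDerivAt_id x).sub_const t)
        rw [ContinuousLinearMap.comp_id] at this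
        exact this
      exact h1.const_mul _

lemma dN_tendsto {n : ℕ} {C : Set (Euc n)} {R : ℝ} {q : Euc n} (h : GoodC C R) (hq : q ∈ C)
    {L : ℕ → Euc n →L[ℝ] ℝ} {l : Euc n →L[ℝ] ℝ} (hL : Tendsto L atTop (nhds l)) :
    Tendsto (fun j => dualNorm C q (L j)) atTop (nhds (dualNorm C q l)) := by
  have hz : Tendsto (fun j => 2 * R * ‖L j - l‖) atTop (nhds 0) := by
    have := (tendsto_iff_norm_sub_tendsto_zero.1 hL).const_mul (2 * R)
    rwa [mul_zero] at this
  rw [tendsto_iff_norm_sub_tendsto_zero]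
  refine squeeze_zero (fun j => norm_nonneg _) (fun j => ?_) hz
  rw [Real.norm_eq_abs, abs_le]
  have h1 := dN_sub h hq (L j) l
  have h2 := dN_sub h hq l (L j)
  rw [norm_sub_rev] at h2
  constructor <;> linarith

lemma cheeger_L2_lip {n : ℕ} {C Ω S' : Set (Euc n)} {R : ℝ} {f : Euc n → ℝ} {K : ℝ≥0}
    (h : GoodC C R)
    (hn : 2 ≤ n) (hΩ : Ω ⊆ C) (hf : LipschitzWith K f) (hfc : HasCompactSupport f)
    (hS' : IsCompact S') (hSS : tsupport f ⊆ interior S') (hS'Ω : S' ⊆ Ω) :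
    cheegerND C Ω ^ 2 * ∫ q in S', f q ^ 2 ∂hMeasure C ≤
      4 * cc n ^ 2 * ∫ q in S', dualNorm C q (fderiv ℝ f q) ^ 2 ∂hMeasure C := by
  have hS'C : S' ⊆ C := hS'Ω.trans hΩ
  obtain ⟨g, M, hg, hgM, hgK, hgt, hgd⟩ := mollify hf hfc isOpen_interior hSS
  set μ := (hMeasure C).restrict S' with hμ
  have : IsFiniteMeasure μ := ⟨by
    rw [hμ, Measure.restrict_apply_univ]; exact hMeasure_compact h hS' hS'C⟩
  have hae : ∀ᵐ q ∂μ, q ∈ S' := ae_restrict_mem hS'.measurableSet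
  have hR := h.Rpos
  have hD : ∀ k : Euc n → ℝ, AEStronglyMeasurable (fun q => dualNorm C q (fderiv ℝ k q) ^ 2) μ :=
    fun k => ((dN_aem h (measurable_fderiv ℝ k)).mono_measure
      Measure.restrict_le_self).aestronglyMeasurable.pow 2
  have hμv : μ ≪ volume := (Measure.restrict_le_self.absolutelyContinuous).trans (hMeasure_ac' C)
  have t1 : Tendsto (fun j => ∫ q, g j q ^ 2 ∂μ) atTop (nhds (∫ q, f q ^ 2 ∂μ)) := by
    refine tendsto_integral_filter_of_dominated_convergence (fun _ => M ^ 2) ?_ ?_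
      (integrable_const _) ?_
    · filter_upwards [hg] with j hj
      exact (hj.1.continuous.pow 2).aestronglyMeasurable
    · refine Eventually.of_forall fun j => Eventually.of_forall fun q => ?_
      rw [norm_pow]
      exact pow_le_pow_left₀ (norm_nonneg _) (hgM j q) 2
    · exact Eventually.of_forall fun q => (hgt q).pow 2
  have t2 : Tendsto (fun j => ∫ q, dualNorm C q (fderiv ℝ (g j) q) ^ 2 ∂μ) atTop
      (nhds (∫ q, dualNorm C q (fderiv ℝ f q) ^ 2 ∂μ)) := by
    refine tendsto_integral_filter_of_dominated_convergence (fun _ => (2 * R * K) ^ 2) ?_ ?_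
      (integrable_const _) ?_
    · exact Eventually.of_forall fun j => hD _
    · refine Eventually.of_forall fun j => ?_
      filter_upwards [hae] with q hq
      rw [norm_pow, Real.norm_eq_abs, abs_of_nonneg (dN_nonneg h (hS'C hq) _)]
      refine pow_le_pow_left₀ (dN_nonneg h (hS'C hq) _) ((dN_le_norm h (hS'C hq) _).trans ?_) 2
      exact mul_le_mul_of_nonneg_left (hgK j q) (by positivity)
    · filter_upwards [hae, hμv.ae_le hgd] with q hq hd
      refine Tendsto.pow ?_ 2
      exact dN_tendsto h (hS'C hq) hd
  refine le_of_tendsto_of_tendsto (t1.const_mul _) (t2.const_mul _) ?_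
  filter_upwards [hg] with j hj
  exact cheeger_L2_smooth h hn hΩ hj.1 hj.2.1 hS' hj.2.2 hS'Ω

lemma hMeasure_open_pos {n : ℕ} {C U : Set (Euc n)} {R : ℝ} (h : GoodC C R) (hU : IsOpen U)
    (hUC : U ⊆ C) (hne : U.Nonempty) : hMeasure C U ≠ 0 := by
  intro h0
  rw [hMeasure_apply C hU.measurableSet hUC, lintegral_eq_zero_iff'] at h0
  · have h1 : ∀ᵐ q ∂(volume.restrict U), False := by
      filter_upwards [h0, ae_restrict_mem hU.measurableSet] with q hq hqU
      have : 0 < hdens C q := div_pos omega_pos (TBr_pos h (hUC hqU))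
      simp only [Pi.zero_apply, ENNReal.ofReal_eq_zero] at hq
      linarith
    rw [eventually_false_iff_eq_bot, ae_eq_bot, Measure.restrict_eq_zero] at h1
    exact (hU.measure_pos volume hne).ne' h1
  · exact (((hdens_contOn h).mono hUC).aemeasurable hU.measurableSet).ennreal_ofReal

lemma rayleigh_ge {n : ℕ} {C Ω : Set (Euc n)} {R : ℝ} {f : Euc n → ℝ} (h : GoodC C R)
    (hn : 2 ≤ n) (hΩo : IsOpen Ω) (hΩ : Ω ⊆ C) (hf : f ∈ testFuns Ω) :
    1 / (4 * cc n ^ 2) * cheegerND C Ω ^ 2 ≤ rayleigh C Ω f := by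
  obtain ⟨⟨K, hK⟩, hf0, hfc, hfΩ⟩ := hf
  obtain ⟨S', hS', hSS, hS'Ω⟩ := exists_compact_between hfc.isCompact hΩo hfΩ
  have key := cheeger_L2_lip h hn hΩ hK hfc hS' hSS hS'Ω
  have hts : ∀ x ∈ Ω \ S', x ∉ tsupport f := fun x hx hxt => hx.2 (interior_subset (hSS hxt))
  have e1 : ∫ q in Ω, f q ^ 2 ∂hMeasure C = ∫ q in S', f q ^ 2 ∂hMeasure C := by
    refine setIntegral_eq_of_subset_of_forall_sdiff_eq_zero hΩo.measurableSet hS'Ω fun x hx => ?_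
    rw [image_eq_zero_of_notMem_tsupport (hts x hx)]; norm_num
  have e2 : ∫ q in Ω, dualNorm C q (fderiv ℝ f q) ^ 2 ∂hMeasure C =
      ∫ q in S', dualNorm C q (fderiv ℝ f q) ^ 2 ∂hMeasure C := by
    refine setIntegral_eq_of_subset_of_forall_sdiff_eq_zero hΩo.measurableSet hS'Ω fun x hx => ?_
    have hz : fderiv ℝ f x = 0 := by
      by_contra hne
      exact hts x hx (support_fderiv_subset ℝ hne)
    rw [hz, dN_zero h (hΩ hx.1)]; norm_num
  unfold rayleigh
  rw [e1, e2]
  have hS'C : S' ⊆ C := hS'Ω.trans hΩ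
  set μ := (hMeasure C).restrict S' with hμ
  have : IsFiniteMeasure μ := ⟨by
    rw [hμ, Measure.restrict_apply_univ]; exact hMeasure_compact h hS' hS'C⟩
  obtain ⟨M, hM⟩ := hK.continuous.bounded_above_of_compact_support hfc
  have if2 : Integrable (fun q => f q ^ 2) μ := by
    refine Integrable.of_bound (hK.continuous.pow 2).aestronglyMeasurable (M ^ 2) ?_
    refine Eventually.of_forall fun q => ?_
    rw [norm_pow]
    exact pow_le_pow_left₀ (norm_nonneg _) (hM q) 2
  have hpos : 0 < ∫ q, f q ^ 2 ∂μ := by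
    refine lt_of_le_of_ne (integral_nonneg fun q => sq_nonneg _) fun h0 => ?_
    rw [eq_comm, integral_eq_zero_iff_of_nonneg (fun q => sq_nonneg _) if2] at h0
    have hUo : IsOpen (Function.support f) := hK.continuous.isOpen_support
    have hUS : Function.support f ⊆ S' := subset_closure.trans (hSS.trans interior_subset)
    have hz : μ (Function.support f) = 0 := by
      refine measure_mono_null ?_ (ae_iff.1 h0)
      intro x hx
      show ¬ (f x ^ 2 = 0)
      exact pow_ne_zero 2 hx
    rw [hμ, Measure.restrict_apply hUo.measurableSet, inter_eq_self_of_subset_left hUS] at hz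
    exact hMeasure_open_pos h hUo (hUS.trans hS'C) (Function.support_nonempty_iff.2 hf0) hz
  have hc : 0 < cc n := cc_pos
  rw [le_div_iff₀ hpos]
  have e : 1 / (4 * cc n ^ 2) * cheegerND C Ω ^ 2 * ∫ q, f q ^ 2 ∂μ =
      (cheegerND C Ω ^ 2 * ∫ q, f q ^ 2 ∂μ) / (4 * cc n ^ 2) := by ring
  rw [e, div_le_iff₀ (by positivity)]
  linarith

lemma testFuns_nonempty {n : ℕ} {Ω : Set (Euc n)} (hΩo : IsOpen Ω) (hne : Ω.Nonempty) :
    (testFuns Ω).Nonempty := by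
  obtain ⟨x, hx⟩ := hne
  obtain ⟨f, h1, h2, h3, -, h5⟩ := exists_contDiff_tsupport_subset (n := 1) (hΩo.mem_nhds hx)
  refine ⟨f, ?_, ?_, h2, h1⟩
  · exact ContDiff.lipschitzWith_of_hasCompactSupport h2 h3 (by norm_num)
  · intro h0; rw [h0] at h5; simp at h5

lemma cheeger_empty {n : ℕ} (C : Set (Euc n)) : cheegerND C ∅ = 0 := by
  unfold cheegerND
  convert Real.sInf_empty
  ext r
  constructor
  · rintro ⟨U, -, hne, hcl, -⟩
    exact (hne.mono (subset_closure.trans hcl)).ne_empty rfl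
  · intro hr; exact hr.elim

lemma lambda1D_nonneg {n : ℕ} (C Ω : Set (Euc n)) : 0 ≤ lambda1D C Ω := by
  apply Real.sInf_nonneg
  rintro _ ⟨f, -, rfl⟩
  exact div_nonneg (integral_nonneg fun q => sq_nonneg _) (integral_nonneg fun q => sq_nonneg _)

lemma main_ge2 {n : ℕ} {C Ω : Set (Euc n)} {R : ℝ} (h : GoodC C R)
    (hn : 2 ≤ n) (hΩo : IsOpen Ω) (hΩ : Ω ⊆ C) :
    1 / (4 * cc n ^ 2) * cheegerND C Ω ^ 2 ≤ lambda1D C Ω := by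
  rcases Ω.eq_empty_or_nonempty with rfl | hne
  · rw [cheeger_empty]
    simpa using lambda1D_nonneg C (∅ : Set (Euc n))
  · refine le_csInf ((testFuns_nonempty hΩo hne).image _) ?_
    rintro _ ⟨f, hf, rfl⟩
    exact rayleigh_ge h hn hΩo hΩ hf

lemma hausD_top {n : ℕ} (hn : n < 2) (C S : Set (Euc n)) :
    hausD ((n : ℝ) - 1) (hDist C) S = ⊤ := by
  rw [eq_top_iff]
  unfold hausD
  refine le_trans ?_ (le_iSup₂ (1 : ℝ≥0∞) one_pos)
  refine le_iInf fun U => le_iInf fun _ => le_iInf fun _ => ?_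
  have h1 : ∀ i, (1 : ℝ≥0∞) ≤ ediamD (hDist C) (U i) ^ ((n : ℝ) - 1) := by
    intro i
    interval_cases n
    · have h0 : ediamD (hDist C) (U i) = 0 := by
        unfold ediamD
        simp only [ENNReal.iSup_eq_zero]
        intro x _ y _
        rw [Subsingleton.elim x y]
        simp [hDist]
      rw [h0, ENNReal.zero_rpow_of_neg (by norm_num)]
      exact le_top
    · norm_num
  refine le_trans (le_of_eq ?_) (ENNReal.tsum_le_tsum h1)
  exact (ENNReal.tsum_const_eq_top_of_ne_zero one_ne_zero).symm

lemma cheeger_low {n : ℕ} (hn : n < 2) (C Ω : Set (Euc n)) : cheegerND C Ω = 0 := by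
  refine le_antisymm ?_ (cheeger_nonneg C Ω)
  apply Real.sInf_nonpos
  rintro r ⟨U, -, -, -, -, rfl⟩
  rw [hausD_top hn]; simp




/-- if the bounded open convex set `C ⊆ ℝⁿ` has a `C¹`, strictly convex
boundary, then there is `K = K(n) > 0`, depending only on `n`, with
`λ₁^C(Ω) ≥ K·(I_∞^C(Ω))²` for every open `Ω` with closure in `C`; in particular
`λ₁(C) ≥ K·I_∞(C)²`. -/
theorem stmt17 {n : ℕ} :
    ∃ K : ℝ, 0 < K ∧ ∀ C : Set (Euc n), Convex ℝ C → IsOpen C →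
      Bornology.IsBounded C → C.Nonempty → HasC1Boundary C → IsStrictlyConvexSet C →
      (∀ Ω : Set (Euc n), IsOpen Ω → closure Ω ⊆ C →
        lambda1D C Ω ≥ K * cheegerND C Ω ^ 2) ∧
      lambda1 C ≥ K * cheegerND C C ^ 2 := by
  by_cases hn : 2 ≤ n
  · have hc : 0 < cc n := cc_pos
    refine ⟨1 / (4 * cc n ^ 2), by positivity, fun C hconv hop hb _ _ _ => ?_⟩
    obtain ⟨R, hR0, hR⟩ := hb.exists_pos_norm_le
    have h : GoodC C R := ⟨hconv, hop, hR0, hR⟩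
    exact ⟨fun Ω hΩ hcl => main_ge2 h hn hΩ (subset_closure.trans hcl),
      main_ge2 h hn hop subset_rfl⟩
  · push Not at hn
    refine ⟨1, one_pos, fun C _ _ _ _ _ _ => ⟨fun Ω _ _ => ?_, ?_⟩⟩
    · rw [cheeger_low hn]; simpa using lambda1D_nonneg C Ω
    · rw [cheeger_low hn]; simpa [lambda1] using lambda1D_nonneg C C
end

section
/- Let T be the interior of a nondegenerate triangle in ℝ² (the convex hull of three affinely independent points). Then the bottom of the spectrum of the Hilbert geometry of T is zero: λ₁(T) = 0. -/
open MeasureTheory Set Filter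
open scoped ENNReal NNReal

namespace HilbTri

noncomputable section

/-- open triangle -/
def tri (b : AffineBasis (Fin 3) ℝ (Euc 2)) : Set (Euc 2) := {x | ∀ i, 0 < b.coord i x}

/-- linear part of the barycentric coordinates -/
def lin (b : AffineBasis (Fin 3) ℝ (Euc 2)) (i : Fin 3) : Euc 2 →L[ℝ] ℝ :=
  LinearMap.toContinuousLinearMap (b.coord i).linear

/-- log coordinates -/
def G (b : AffineBasis (Fin 3) ℝ (Euc 2)) (p : Euc 2) : Euc 2 :=
  !₂[Real.log (b.coord 0 p) - Real.log (b.coord 2 p),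
    Real.log (b.coord 1 p) - Real.log (b.coord 2 p)]

/-- derivative of log coordinates -/
def L (b : AffineBasis (Fin 3) ℝ (Euc 2)) (p : Euc 2) : Euc 2 →L[ℝ] Euc 2 :=
  ((EuclideanSpace.equiv (Fin 2) ℝ).symm : (Fin 2 → ℝ) →L[ℝ] Euc 2).comp
    (ContinuousLinearMap.pi ![(b.coord 0 p)⁻¹ • lin b 0 - (b.coord 2 p)⁻¹ • lin b 2,
      (b.coord 1 p)⁻¹ • lin b 1 - (b.coord 2 p)⁻¹ • lin b 2])

/-- inverse of log coordinates -/
def Psi (b : AffineBasis (Fin 3) ℝ (Euc 2)) (z : Euc 2) : Euc 2 :=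
  (Real.exp (z 0) / (Real.exp (z 0) + Real.exp (z 1) + 1)) • (b 0 - b 2) +
  (Real.exp (z 1) / (Real.exp (z 0) + Real.exp (z 1) + 1)) • (b 1 - b 2) + b 2

/-- hexagon -/
def hex : Set (Euc 2) :=
  {z | (1 / 2) * (max (z 0) (max (z 1) 0) - min (z 0) (min (z 1) 0)) < 1}

variable (b : AffineBasis (Fin 3) ℝ (Euc 2))

lemma coord_line (i : Fin 3) (p u : Euc 2) (t : ℝ) :
    b.coord i (p + t • u) = b.coord i p + t * lin b i u := by
  have := (b.coord i).map_vadd p (t • u)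
  simp only [vadd_eq_add, map_smul, smul_eq_mul] at this
  rw [add_comm, this, add_comm]; rfl

lemma coord_add (i : Fin 3) (p u : Euc 2) :
    b.coord i (u + p) = b.coord i p + lin b i u := by
  have := coord_line b i p u 1
  simpa [add_comm] using this

lemma lin_sub (i j k : Fin 3) : lin b i (b j - b k) = b.coord i (b j) - b.coord i (b k) := by
  have := coord_add b i (b k) (b j - b k)
  simp only [sub_add_cancel] at this
  linarith

lemma sum_coord (p : Euc 2) : b.coord 0 p + b.coord 1 p + b.coord 2 p = 1 := by
  have := b.sum_coord_apply_eq_one p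
  rwa [Fin.sum_univ_three] at this

lemma sum_lin (u : Euc 2) : lin b 0 u + lin b 1 u + lin b 2 u = 0 := by
  have h1 := sum_coord b (u + 0)
  have h2 := sum_coord b 0
  simp only [coord_add] at h1
  linarith

lemma lin_inj (u : Euc 2) (h : ∀ i, lin b i u = 0) : u = 0 := by
  have : u + 0 = 0 := b.ext_elem (fun i => by rw [coord_add, h, add_zero])
  simpa using this

lemma L_zero (p u : Euc 2) :
    L b p u 0 = lin b 0 u / b.coord 0 p - lin b 2 u / b.coord 2 p := by
  simp [L, div_eq_inv_mul]

lemma L_one (p u : Euc 2) :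
    L b p u 1 = lin b 1 u / b.coord 1 p - lin b 2 u / b.coord 2 p := by
  simp [L, div_eq_inv_mul]

lemma hasFDerivAt_coord (i : Fin 3) (p : Euc 2) : HasFDerivAt (b.coord i) (lin b i) p := by
  have : (b.coord i : Euc 2 → ℝ) = fun x => lin b i x + b.coord i 0 := by
    funext x
    have := coord_add b i 0 x
    rw [add_zero] at this; rw [this, add_comm]
  rw [this]
  exact (lin b i).hasFDerivAt.add_const _

lemma contDiff_coord (i : Fin 3) : ContDiff ℝ 1 (b.coord i) := by
  have : (b.coord i : Euc 2 → ℝ) = fun x => lin b i x + b.coord i 0 := by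
    funext x
    have := coord_add b i 0 x
    rw [add_zero] at this; rw [this, add_comm]
  rw [this]
  exact (lin b i).contDiff.add contDiff_const

lemma isOpen_tri : IsOpen (tri b) := by
  have : tri b = ⋂ i, {x | 0 < b.coord i x} := by ext; simp [tri]
  rw [this]
  exact isOpen_iInter_of_finite fun i =>
    isOpen_lt continuous_const (contDiff_coord b i).continuous

lemma hasFDerivAt_G {p : Euc 2} (hp : p ∈ tri b) : HasFDerivAt (G b) (L b p) p := by
  rw [← hasFDerivWithinAt_univ, hasFDerivWithinAt_euclidean]
  simp only [hasFDerivWithinAt_univ]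
  have hl : ∀ i, HasFDerivAt (fun x => Real.log (b.coord i x)) ((b.coord i p)⁻¹ • lin b i) p :=
    fun i => (hasFDerivAt_coord b i p).log (hp i).ne'
  intro i
  fin_cases i
  · convert! (hl 0).sub (hl 2) using 1
  · convert! (hl 1).sub (hl 2) using 1

lemma contDiffAt_G {p : Euc 2} (hp : p ∈ tri b) : ContDiffAt ℝ 1 (G b) p := by
  rw [contDiffAt_euclidean]
  have hl : ∀ i, ContDiffAt ℝ 1 (fun x => Real.log (b.coord i x)) p :=
    fun i => (contDiff_coord b i).contDiffAt.log (hp i).ne'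
  intro i
  fin_cases i
  · exact (hl 0).sub (hl 2)
  · exact (hl 1).sub (hl 2)

lemma coord_Psi (z : Euc 2) :
    b.coord 0 (Psi b z) = Real.exp (z 0) / (Real.exp (z 0) + Real.exp (z 1) + 1) ∧
    b.coord 1 (Psi b z) = Real.exp (z 1) / (Real.exp (z 0) + Real.exp (z 1) + 1) ∧
    b.coord 2 (Psi b z) = 1 / (Real.exp (z 0) + Real.exp (z 1) + 1) := by
  have h0 := Real.exp_pos (z 0)
  have h1 := Real.exp_pos (z 1)
  refine ⟨?_, ?_, ?_⟩ <;>
  · unfold Psi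
    rw [coord_add, map_add, map_smul, map_smul, lin_sub, lin_sub]
    simp
    try (field_simp; ring)

lemma Psi_mem (z : Euc 2) : Psi b z ∈ tri b := by
  obtain ⟨h0, h1, h2⟩ := coord_Psi b z
  intro i
  fin_cases i
  · show 0 < b.coord 0 _
    rw [h0]; positivity
  · show 0 < b.coord 1 _
    rw [h1]; positivity
  · show 0 < b.coord 2 _
    rw [h2]; positivity

lemma G_Psi (z : Euc 2) : G b (Psi b z) = z := by
  obtain ⟨h0, h1, h2⟩ := coord_Psi b z
  have hS : Real.exp (z 0) + Real.exp (z 1) + 1 ≠ 0 := by positivity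
  ext i
  fin_cases i
  · simp [G, h0, h2, Real.log_div (Real.exp_pos (z 0)).ne' hS]
  · simp [G, h1, h2, Real.log_div (Real.exp_pos (z 1)).ne' hS]

lemma G_inj : InjOn (G b) (tri b) := by
  intro p hp q hq h
  have e0 : G b p 0 = G b q 0 := by rw [h]
  have e1 : G b p 1 = G b q 1 := by rw [h]
  simp only [G] at e0 e1
  simp at e0 e1
  have hp0 := hp 0; have hp1 := hp 1; have hp2 := hp 2
  have hq0 := hq 0; have hq1 := hq 1; have hq2 := hq 2
  rw [← Real.log_div hp0.ne' hp2.ne', ← Real.log_div hq0.ne' hq2.ne'] at e0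
  rw [← Real.log_div hp1.ne' hp2.ne', ← Real.log_div hq1.ne' hq2.ne'] at e1
  have f0 := Real.log_injOn_pos (div_pos hp0 hp2) (div_pos hq0 hq2) e0
  have f1 := Real.log_injOn_pos (div_pos hp1 hp2) (div_pos hq1 hq2) e1
  rw [div_eq_div_iff hp2.ne' hq2.ne'] at f0 f1
  have sp := sum_coord b p
  have sq := sum_coord b q
  have k2 : b.coord 2 p = b.coord 2 q := by
    linear_combination (-b.coord 2 p) * sq + b.coord 2 q * sp - f0 - f1
  have k0 : b.coord 0 p = b.coord 0 q := by
    rw [k2] at f0; exact mul_right_cancel₀ hq2.ne' f0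
  have k1 : b.coord 1 p = b.coord 1 q := by
    rw [k2] at f1; exact mul_right_cancel₀ hq2.ne' f1
  apply b.ext_elem
  intro i
  fin_cases i
  · exact k0
  · exact k1
  · exact k2

lemma continuous_Psi : Continuous (Psi b) := by
  unfold Psi
  have hS : ∀ z : Euc 2, Real.exp (z 0) + Real.exp (z 1) + 1 ≠ 0 := fun z => by positivity
  have h0 : Continuous fun z : Euc 2 => Real.exp (z 0) := by fun_prop
  have h1 : Continuous fun z : Euc 2 => Real.exp (z 1) := by fun_prop
  exact (((h0.div ((h0.add h1).add continuous_const) hS).smul continuous_const).add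
    ((h1.div ((h0.add h1).add continuous_const) hS).smul continuous_const)).add continuous_const

/-- log disc -/
def D (R : ℝ) : Set (Euc 2) := {p | p ∈ tri b ∧ ‖G b p‖ ≤ R}

lemma Psi_G {p : Euc 2} (hp : p ∈ tri b) : Psi b (G b p) = p :=
  G_inj b (Psi_mem b _) hp (G_Psi b _)

lemma D_eq (R : ℝ) : D b R = Psi b '' Metric.closedBall 0 R := by
  ext p
  constructor
  · rintro ⟨hp, h⟩
    exact ⟨G b p, by simpa using h, Psi_G b hp⟩
  · rintro ⟨z, hz, rfl⟩
    exact ⟨Psi_mem b z, by rw [G_Psi]; simpa using hz⟩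

lemma isCompact_D (R : ℝ) : IsCompact (D b R) := by
  rw [D_eq]
  exact (isCompact_closedBall 0 R).image (continuous_Psi b)

lemma G_image_D (R : ℝ) : G b '' D b R = Metric.closedBall 0 R := by
  rw [D_eq, image_image]
  simp [G_Psi]

lemma line_aux (w0 w1 w2 M m : ℝ) (hM : M = max w0 (max w1 w2)) (hm : m = min w0 (min w1 w2))
    (hM0 : 0 < M) (hm0 : m < 0) :
    {t : ℝ | 0 < 1 + t * w0 ∧ 0 < 1 + t * w1 ∧ 0 < 1 + t * w2} = Ioo (-1 / M) (-1 / m) := by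
  have a0 : w0 ≤ M := by rw [hM]; simp
  have a1 : w1 ≤ M := by rw [hM]; simp
  have a2 : w2 ≤ M := by rw [hM]; simp
  have b0 : m ≤ w0 := by rw [hm]; simp
  have b1 : m ≤ w1 := by rw [hm]; simp
  have b2 : m ≤ w2 := by rw [hm]; simp
  have cM : M = w0 ∨ M = w1 ∨ M = w2 := by
    rw [hM]; rcases max_choice w0 (max w1 w2) with h | h <;> rcases max_choice w1 w2 with h' | h' <;>
      rw [h] <;> simp [h']
  have cm : m = w0 ∨ m = w1 ∨ m = w2 := by
    rw [hm]; rcases min_choice w0 (min w1 w2) with h | h <;> rcases min_choice w1 w2 with h' | h' <;>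
      rw [h] <;> simp [h']
  ext t
  rw [mem_Ioo, div_lt_iff₀ hM0, lt_div_iff_of_neg hm0]
  constructor
  · rintro ⟨h0, h1, h2⟩
    constructor
    · rcases cM with h | h | h <;> rw [h] <;> linarith
    · rcases cm with h | h | h <;> rw [h] <;> linarith
  · rintro ⟨h1, h2⟩
    have key : ∀ w, w ≤ M → m ≤ w → 0 < 1 + t * w := by
      intro w hw hw'
      rcases le_total 0 t with ht | ht
      · nlinarith
      · nlinarith
    exact ⟨key _ a0 b0, key _ a1 b1, key _ a2 b2⟩

lemma fNorm_eq {p : Euc 2} (hp : p ∈ tri b) (u : Euc 2) :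
    fNorm (tri b) p u = (1 / 2) * (max (L b p u 0) (max (L b p u 1) 0) -
      min (L b p u 0) (min (L b p u 1) 0)) := by
  by_cases hu : u = 0
  · subst hu; simp [fNorm]
  have hp0 := hp 0; have hp1 := hp 1; have hp2 := hp 2
  rw [L_zero, L_one]
  set w0 := lin b 0 u / b.coord 0 p with hw0
  set w1 := lin b 1 u / b.coord 1 p with hw1
  set w2 := lin b 2 u / b.coord 2 p with hw2
  have l0 : lin b 0 u = b.coord 0 p * w0 := by rw [hw0]; field_simp
  have l1 : lin b 1 u = b.coord 1 p * w1 := by rw [hw1]; field_simp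
  have l2 : lin b 2 u = b.coord 2 p * w2 := by rw [hw2]; field_simp
  have hs := sum_lin b u
  have hne : ¬ (w0 = 0 ∧ w1 = 0 ∧ w2 = 0) := by
    rintro ⟨h0, h1, h2⟩
    rw [h0, mul_zero] at l0
    rw [h1, mul_zero] at l1
    rw [h2, mul_zero] at l2
    apply hu
    apply lin_inj b
    intro i
    fin_cases i
    exacts [l0, l1, l2]
  rw [l0, l1, l2] at hs
  have hM0 : 0 < max w0 (max w1 w2) := by
    by_contra hcon
    simp only [not_lt, max_le_iff] at hcon
    obtain ⟨h0, h1, h2⟩ := hcon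
    have q0 := mul_nonneg hp0.le (neg_nonneg.2 h0)
    have q1 := mul_nonneg hp1.le (neg_nonneg.2 h1)
    have q2 := mul_nonneg hp2.le (neg_nonneg.2 h2)
    refine hne ⟨?_, ?_, ?_⟩
    · exact (mul_eq_zero.1 (show b.coord 0 p * w0 = 0 by linarith)).resolve_left hp0.ne'
    · exact (mul_eq_zero.1 (show b.coord 1 p * w1 = 0 by linarith)).resolve_left hp1.ne'
    · exact (mul_eq_zero.1 (show b.coord 2 p * w2 = 0 by linarith)).resolve_left hp2.ne'
  have hm0 : min w0 (min w1 w2) < 0 := by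
    by_contra hcon
    simp only [not_lt, le_min_iff] at hcon
    obtain ⟨h0, h1, h2⟩ := hcon
    have q0 := mul_nonneg hp0.le h0
    have q1 := mul_nonneg hp1.le h1
    have q2 := mul_nonneg hp2.le h2
    refine hne ⟨?_, ?_, ?_⟩
    · exact (mul_eq_zero.1 (show b.coord 0 p * w0 = 0 by linarith)).resolve_left hp0.ne'
    · exact (mul_eq_zero.1 (show b.coord 1 p * w1 = 0 by linarith)).resolve_left hp1.ne'
    · exact (mul_eq_zero.1 (show b.coord 2 p * w2 = 0 by linarith)).resolve_left hp2.ne'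
  have hset : lineParams (tri b) p u =
      Ioo (-1 / max w0 (max w1 w2)) (-1 / min w0 (min w1 w2)) := by
    rw [← line_aux w0 w1 w2 _ _ rfl rfl hM0 hm0]
    ext t
    simp only [lineParams, tri, mem_ofPred_eq, Fin.forall_fin_succ, coord_line]
    have e : ∀ c w l : ℝ, 0 < c → l = c * w → (0 < c + t * l ↔ 0 < 1 + t * w) := by
      intro c w l hc hl
      rw [hl, show c + t * (c * w) = c * (1 + t * w) by ring]
      exact mul_pos_iff_of_pos_left hc
    have e0 := e _ _ _ hp0 l0
    have e1 := e _ _ _ hp1 l1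
    have e2 := e _ _ _ hp2 l2
    simp
    rw [← e0, ← e1, ← e2]
  have hlt : -1 / max w0 (max w1 w2) < -1 / min w0 (min w1 w2) := by
    have h1 : -1 / max w0 (max w1 w2) < 0 := div_neg_of_neg_of_pos (by norm_num) hM0
    have h2 : 0 < -1 / min w0 (min w1 w2) := div_pos_of_neg_of_neg (by norm_num) hm0
    linarith
  have eM : max (w0 - w2) (max (w1 - w2) 0) = max w0 (max w1 w2) - w2 := by
    rw [← max_sub_sub_right, ← max_sub_sub_right, sub_self]
  have em : min (w0 - w2) (min (w1 - w2) 0) = min w0 (min w1 w2) - w2 := by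
    rw [← min_sub_sub_right, ← min_sub_sub_right, sub_self]
  rw [eM, em]
  simp only [fNorm, if_neg hu, hset, csSup_Ioo hlt, csInf_Ioo hlt]
  field_simp
  ring

lemma tangentBall_eq {p : Euc 2} (hp : p ∈ tri b) : tangentBall (tri b) p 1 = L b p ⁻¹' hex := by
  ext u
  simp only [tangentBall, mem_ofPred_eq, fNorm_eq b hp, hex, mem_preimage]

lemma det_L {p : Euc 2} (hp : p ∈ tri b) : (L b p).det ≠ 0 := by
  have hinj : LinearMap.ker (L b p : Euc 2 →ₗ[ℝ] Euc 2) = ⊥ := by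
    rw [LinearMap.ker_eq_bot']
    intro u hu
    have hu' : L b p u = 0 := hu
    have h0 := L_zero b p u
    have h1 := L_one b p u
    rw [hu'] at h0 h1
    simp at h0 h1
    have hp0 := hp 0; have hp1 := hp 1; have hp2 := hp 2
    have l0 : lin b 0 u = b.coord 0 p * (lin b 2 u / b.coord 2 p) := by
      rw [sub_eq_zero.1 h0.symm |>.symm]; field_simp
    have l1 : lin b 1 u = b.coord 1 p * (lin b 2 u / b.coord 2 p) := by
      rw [sub_eq_zero.1 h1.symm |>.symm]; field_simp
    have l2 : lin b 2 u = b.coord 2 p * (lin b 2 u / b.coord 2 p) := by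
      field_simp
    have hs := sum_lin b u
    have hc := sum_coord b p
    have hz : lin b 2 u / b.coord 2 p = 0 := by
      linear_combination (-(lin b 2 u / b.coord 2 p)) * hc + hs - l0 - l1 - l2
    rw [hz, mul_zero] at l0 l1 l2
    apply lin_inj b
    intro i
    fin_cases i
    exacts [l0, l1, l2]
  exact (LinearMap.isUnit_iff_ker_eq_bot _ |>.2 hinj |> (LinearMap.isUnit_iff_isUnit_det _).1).ne_zero

lemma norm_L_le {p : Euc 2} (hp : p ∈ tri b) (u : Euc 2) :
    ‖L b p u‖ ≤ 4 * fNorm (tri b) p u := by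
  rw [fNorm_eq b hp]
  set x := L b p u 0
  set y := L b p u 1
  have h : ‖L b p u‖ ≤ |x| + |y| := by
    rw [EuclideanSpace.norm_eq, Fin.sum_univ_two]
    apply Real.sqrt_le_iff.2
    simp only [Real.norm_eq_abs]
    refine ⟨by positivity, ?_⟩
    nlinarith [mul_nonneg (abs_nonneg x) (abs_nonneg y)]
  have hx1 : x ≤ max x (max y 0) := le_max_left _ _
  have hy1 : y ≤ max x (max y 0) := (le_max_left _ _).trans (le_max_right _ _)
  have hz1 : 0 ≤ max x (max y 0) := (le_max_right _ _).trans (le_max_right _ _)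
  have hx2 : min x (min y 0) ≤ x := min_le_left _ _
  have hy2 : min x (min y 0) ≤ y := (min_le_right _ _).trans (min_le_left _ _)
  have hz2 : min x (min y 0) ≤ 0 := (min_le_right _ _).trans (min_le_right _ _)
  have : |x| ≤ max x (max y 0) - min x (min y 0) := abs_le.2 ⟨by linarith, by linarith⟩
  have : |y| ≤ max x (max y 0) - min x (min y 0) := abs_le.2 ⟨by linarith, by linarith⟩
  linarith

/-- constant density factor -/
def K : ℝ := omegaVol 2 / (volume hex).toReal

lemma K_nonneg : 0 ≤ K := div_nonneg ENNReal.toReal_nonneg ENNReal.toReal_nonneg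

lemma density_eq {p : Euc 2} (hp : p ∈ tri b) :
    ENNReal.ofReal (omegaVol 2 / (volume (tangentBall (tri b) p 1)).toReal) =
      ENNReal.ofReal K * ENNReal.ofReal |(L b p).det| := by
  have hd := det_L b hp
  rw [tangentBall_eq b hp, Measure.addHaar_preimage_continuousLinearMap volume hd,
    ENNReal.toReal_mul, ENNReal.toReal_ofReal (abs_nonneg _), ← ENNReal.ofReal_mul K_nonneg]
  congr 1
  change _ = K * |LinearMap.det (L b p : Euc 2 →ₗ[ℝ] Euc 2)|
  rw [abs_inv, K]
  have : |LinearMap.det (L b p : Euc 2 →ₗ[ℝ] Euc 2)| ≠ 0 := abs_ne_zero.2 hd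
  rw [div_mul_eq_div_div, div_inv_eq_mul]
  ring

lemma measure_D (R : ℝ) :
    hMeasure (tri b) (D b R) = ENNReal.ofReal K * volume (Metric.closedBall (0 : Euc 2) R) := by
  have hm : MeasurableSet (D b R) := (isCompact_D b R).isClosed.measurableSet
  have hsub : D b R ⊆ tri b := fun p hp => hp.1
  rw [hMeasure, withDensity_apply _ hm, Measure.restrict_restrict hm,
    inter_eq_self_of_subset_left hsub,
    setLIntegral_congr_fun hm (fun p hp => density_eq b (hsub hp)),
    lintegral_const_mul' _ _ ENNReal.ofReal_ne_top,
    lintegral_abs_det_fderiv_eq_addHaar_image volume hm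
      (fun p hp => (hasFDerivAt_G b (hsub hp)).hasFDerivWithinAt) ((G_inj b).mono hsub),
    G_image_D]

lemma restrict_hMeasure : (hMeasure (tri b)).restrict (tri b) = hMeasure (tri b) := by
  rw [hMeasure, restrict_withDensity (isOpen_tri b).measurableSet, Measure.restrict_restrict
    (isOpen_tri b).measurableSet, inter_self]

lemma ae_tri : ∀ᵐ p ∂(hMeasure (tri b)), p ∈ tri b := by
  rw [← restrict_hMeasure]
  exact ae_restrict_mem (isOpen_tri b).measurableSet

/-- the bump -/
def chi : ContDiffBump (0 : Euc 2) := ⟨1, 2, by norm_num, by norm_num⟩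

open Classical in
/-- test function -/
def tf (R : ℝ) : Euc 2 → ℝ := (tri b).indicator fun p => chi (R⁻¹ • G b p)

lemma tf_zero {R : ℝ} (hR : 0 < R) {p : Euc 2} (hp : p ∉ D b (R * 2)) : tf b R p = 0 := by
  by_cases hpt : p ∈ tri b
  · have : R * 2 < ‖G b p‖ := by
      by_contra hc
      exact hp ⟨hpt, not_lt.1 hc⟩
    rw [tf, indicator_of_mem hpt]
    apply chi.zero_of_le_dist
    rw [dist_zero_right, norm_smul, norm_inv, Real.norm_eq_abs, abs_of_pos hR]
    show (2 : ℝ) ≤ _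
    rw [le_inv_mul_iff₀ hR]
    exact this.le
  · rw [tf, indicator_of_notMem hpt]

lemma tf_one {R : ℝ} (hR : 0 < R) {p : Euc 2} (hp : p ∈ D b R) : tf b R p = 1 := by
  rw [tf, indicator_of_mem hp.1]
  apply chi.one_of_mem_closedBall
  rw [mem_closedBall_zero_iff, norm_smul, norm_inv, Real.norm_eq_abs, abs_of_pos hR]
  show _ ≤ (1 : ℝ)
  rw [inv_mul_le_iff₀ hR, mul_one]
  exact hp.2

lemma tf_nonneg (R : ℝ) (p : Euc 2) : 0 ≤ tf b R p :=
  indicator_nonneg (fun _ _ => chi.nonneg) p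

lemma tf_le_one (R : ℝ) (p : Euc 2) : tf b R p ≤ 1 :=
  indicator_le' (g := fun _ => (1 : ℝ)) (fun _ _ => chi.le_one) (fun _ _ => zero_le_one) p

lemma tf_tsupport {R : ℝ} (hR : 0 < R) : tsupport (tf b R) ⊆ D b (R * 2) := by
  apply closure_minimal _ (isCompact_D b _).isClosed
  intro p hp
  by_contra hc
  exact hp (tf_zero b hR hc)

lemma tf_eventually (R : ℝ) {p : Euc 2} (hp : p ∈ tri b) :
    tf b R =ᶠ[nhds p] fun p => chi (R⁻¹ • G b p) := by
  filter_upwards [(isOpen_tri b).mem_nhds hp] with q hq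
  rw [tf, indicator_of_mem hq]

lemma tf_contDiff {R : ℝ} (hR : 0 < R) : ContDiff ℝ 1 (tf b R) := by
  rw [contDiff_iff_contDiffAt]
  intro p
  by_cases hp : p ∈ tri b
  · refine ContDiffAt.congr_of_eventuallyEq ?_ (tf_eventually b R hp)
    exact ContDiffAt.comp (g := chi) (f := fun p => R⁻¹ • G b p) p
      (chi.contDiff (n := 1)).contDiffAt ((contDiffAt_G b hp).const_smul R⁻¹)
  · have hp' : p ∉ tsupport (tf b R) := fun h => hp (tf_tsupport b hR h).1
    exact contDiffAt_const.congr_of_eventuallyEq (notMem_tsupport_iff_eventuallyEq.1 hp')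

lemma tf_compact {R : ℝ} (hR : 0 < R) : HasCompactSupport (tf b R) :=
  (isCompact_D b (R * 2)).of_isClosed_subset (isClosed_tsupport _) (tf_tsupport b hR)

lemma tf_mem {R : ℝ} (hR : 0 < R) : tf b R ∈ testFuns (tri b) := by
  refine ⟨ContDiff.lipschitzWith_of_hasCompactSupport (tf_compact b hR) (tf_contDiff b hR)
    one_ne_zero, ?_, tf_compact b hR, fun p hp => (tf_tsupport b hR hp).1⟩
  intro h
  have h1 : tf b R (Psi b 0) = 1 :=
    tf_one b hR ⟨Psi_mem b 0, by rw [G_Psi]; simpa using hR.le⟩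
  rw [h] at h1
  simp at h1

lemma tf_fderiv (R : ℝ) {p : Euc 2} (hp : p ∈ tri b) :
    fderiv ℝ (tf b R) p = (fderiv ℝ chi (R⁻¹ • G b p)).comp (R⁻¹ • L b p) := by
  rw [(tf_eventually b R hp).fderiv_eq]
  have h1 : HasFDerivAt chi (fderiv ℝ chi (R⁻¹ • G b p)) (R⁻¹ • G b p) :=
    ((chi.contDiff (n := 1)).differentiable one_ne_zero _).hasFDerivAt
  exact (h1.comp p ((hasFDerivAt_G b hp).const_smul R⁻¹)).fderiv

lemma dual_le {p : Euc 2} (l : Euc 2 →L[ℝ] ℝ) (c : ℝ) (hc : 0 ≤ c)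
    (h : ∀ u, |l u| ≤ c * fNorm (tri b) p u) : dualNorm (tri b) p l ^ 2 ≤ c ^ 2 := by
  apply sq_le_sq'
  · unfold dualNorm
    rcases Set.eq_empty_or_nonempty ((fun u => l u) '' {u : Euc 2 | fNorm (tri b) p u = 1})
      with he | ⟨x, hx⟩
    · rw [he, Real.sSup_empty]; linarith
    · have hb : BddAbove ((fun u => l u) '' {u : Euc 2 | fNorm (tri b) p u = 1}) := by
        refine ⟨c, ?_⟩
        rintro _ ⟨u, hu, rfl⟩
        have := h u
        rw [show fNorm (tri b) p u = 1 from hu, mul_one] at this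
        exact (abs_le.1 this).2
      refine le_trans ?_ (le_csSup hb hx)
      obtain ⟨u, hu, rfl⟩ := hx
      have := h u
      rw [show fNorm (tri b) p u = 1 from hu, mul_one] at this
      exact (abs_le.1 this).1
  · apply Real.sSup_le _ hc
    rintro _ ⟨u, hu, rfl⟩
    have := h u
    rw [show fNorm (tri b) p u = 1 from hu, mul_one] at this
    exact (abs_le.1 this).2

lemma rayleigh_le : ∃ M : ℝ, 0 ≤ M ∧ ∀ R : ℝ, 0 < R →
    rayleigh (tri b) (tri b) (tf b R) ≤ 4 * (4 * M / R) ^ 2 := by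
  obtain ⟨M, hM⟩ := (chi.hasCompactSupport.fderiv ℝ).exists_bound_of_continuous
    ((chi.contDiff (n := 1)).continuous_fderiv one_ne_zero)
  have hM0 : 0 ≤ M := (norm_nonneg _).trans (hM 0)
  refine ⟨M, hM0, fun R hR => ?_⟩
  have hfin : ∀ r, hMeasure (tri b) (D b r) ≠ ⊤ := fun r => by
    rw [measure_D]
    exact ENNReal.mul_ne_top ENNReal.ofReal_ne_top measure_closedBall_lt_top.ne
  have hmeas : ∀ r, MeasurableSet (D b r) := fun r => (isCompact_D b r).isClosed.measurableSet
  have hint : ∀ r (c : ℝ), Integrable ((D b r).indicator fun _ => c) (hMeasure (tri b)) :=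
    fun r c => (integrable_indicator_iff (hmeas r)).2 (integrableOn_const (hfin r))
  have hI : ∀ r (c : ℝ), ∫ p, (D b r).indicator (fun _ => c) p ∂hMeasure (tri b) =
      (hMeasure (tri b) (D b r)).toReal * c := fun r c => by
    rw [integral_indicator_const _ (hmeas r)]; rfl
  unfold rayleigh
  rw [restrict_hMeasure]
  have hnum : ∫ p, dualNorm (tri b) p (fderiv ℝ (tf b R) p) ^ 2 ∂hMeasure (tri b) ≤
      (hMeasure (tri b) (D b (R * 2))).toReal * (4 * M / R) ^ 2 := by
    rw [← hI]
    refine integral_mono_of_nonneg (Eventually.of_forall fun p => sq_nonneg _) (hint _ _) ?_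
    filter_upwards [ae_tri b] with p hp
    by_cases hpD : p ∈ D b (R * 2)
    · rw [indicator_of_mem hpD]
      apply dual_le b _ _ (by positivity)
      intro u
      rw [tf_fderiv b R hp]
      calc |(fderiv ℝ chi (R⁻¹ • G b p)) (R⁻¹ • L b p u)|
          ≤ ‖fderiv ℝ chi (R⁻¹ • G b p)‖ * ‖R⁻¹ • L b p u‖ :=
            (fderiv ℝ chi (R⁻¹ • G b p)).le_opNorm (R⁻¹ • L b p u)
        _ ≤ M * (R⁻¹ * (4 * fNorm (tri b) p u)) := by
            rw [norm_smul, norm_inv, Real.norm_eq_abs, abs_of_pos hR]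
            have := hM (R⁻¹ • G b p)
            have := norm_L_le b hp u
            gcongr
        _ = 4 * M / R * fNorm (tri b) p u := by field_simp
    · rw [indicator_of_notMem hpD]
      have h0 : fderiv ℝ (tf b R) p = 0 := by
        by_contra hne
        exact hpD (tf_tsupport b hR (support_fderiv_subset ℝ hne))
      rw [h0]
      have := dual_le b (p := p) 0 0 le_rfl (by simp)
      simpa using this
  have hfi : Integrable (fun p => tf b R p ^ 2) (hMeasure (tri b)) := by
    refine (hint (R * 2) 1).mono' ((tf_contDiff b hR).continuous.pow 2).aestronglyMeasurable ?_
    refine Eventually.of_forall fun p => ?_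
    by_cases hpD : p ∈ D b (R * 2)
    · rw [indicator_of_mem hpD, Real.norm_eq_abs, abs_of_nonneg (sq_nonneg _)]
      exact pow_le_one₀ (tf_nonneg b R p) (tf_le_one b R p)
    · simp [tf_zero b hR hpD, hpD]
  have hden : (hMeasure (tri b) (D b R)).toReal * 1 ≤ ∫ p, tf b R p ^ 2 ∂hMeasure (tri b) := by
    rw [← hI]
    refine integral_mono (hint _ _) hfi fun p => ?_
    by_cases hpD : p ∈ D b R
    · simp [hpD, tf_one b hR hpD]
    · simp only [indicator_of_notMem hpD]
      positivity
  have hscale : (hMeasure (tri b) (D b (R * 2))).toReal =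
      4 * (hMeasure (tri b) (D b R)).toReal := by
    rw [measure_D, measure_D, mul_comm R 2, Measure.addHaar_closedBall_mul volume 0 zero_le_two hR.le]
    rw [ENNReal.toReal_mul, ENNReal.toReal_mul, ENNReal.toReal_mul, ENNReal.toReal_ofReal K_nonneg,
      ENNReal.toReal_ofReal (by positivity)]
    simp only [finrank_euclideanSpace, Fintype.card_fin]
    ring
  apply div_le_of_le_mul₀
  · exact integral_nonneg fun p => sq_nonneg _
  · positivity
  · rw [hscale] at hnum
    rw [mul_one] at hden
    calc _ ≤ _ := hnum
      _ = 4 * (4 * M / R) ^ 2 * (hMeasure (tri b) (D b R)).toReal := by ring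
      _ ≤ _ := by gcongr

lemma lambda_tri : lambda1 (tri b) = 0 := by
  have hnn : ∀ f, 0 ≤ rayleigh (tri b) (tri b) f := fun f =>
    div_nonneg (integral_nonneg fun p => sq_nonneg _) (integral_nonneg fun p => sq_nonneg _)
  have hlb : ∀ x ∈ rayleigh (tri b) (tri b) '' testFuns (tri b), 0 ≤ x := by
    rintro _ ⟨f, -, rfl⟩
    exact hnn f
  obtain ⟨M, hM0, hM⟩ := rayleigh_le b
  apply le_antisymm
  · have hlim : Tendsto (fun R : ℝ => 4 * (4 * M / R) ^ 2) atTop (nhds (4 * 0 ^ 2)) :=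
      ((tendsto_const_nhds.div_atTop tendsto_id).pow 2).const_mul 4
    have : lambda1 (tri b) ≤ 4 * 0 ^ 2 := by
      apply ge_of_tendsto hlim
      filter_upwards [eventually_gt_atTop 0] with R hR
      exact (csInf_le ⟨0, hlb⟩ (mem_image_of_mem _ (tf_mem b hR))).trans (hM R hR)
    simpa using this
  · exact Real.sInf_nonneg hlb

end

end HilbTri

/-- the bottom of the spectrum of the Hilbert geometry of the interior
of a nondegenerate triangle in `ℝ²` is zero. -/
theorem stmt19 (a b c : Euc 2) (h : AffineIndependent ℝ ![a, b, c]) :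
    lambda1 (interior (convexHull ℝ {a, b, c})) = 0 := by
  have htop : affineSpan ℝ (range ![a, b, c]) = ⊤ := by
    rw [h.affineSpan_eq_top_iff_card_eq_finrank_add_one]
    simp
  have key := HilbTri.lambda_tri ⟨![a, b, c], h, htop⟩
  have hr : ({a, b, c} : Set (Euc 2)) = range ![a, b, c] := by
    rw [Matrix.range_cons, Matrix.range_cons, Matrix.range_cons, Matrix.range_empty, union_empty]
    rfl
  rw [hr]
  have := AffineBasis.interior_convexHull (⟨![a, b, c], h, htop⟩ : AffineBasis (Fin 3) ℝ (Euc 2))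
  change interior (convexHull ℝ (range ![a, b, c])) = _ at this
  rw [this]
  exact key
end
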